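/- arXiv:2005.04592 — 10 statements merged into one kernel-verified Lean document; each statement's English description precedes it below -/
import Mathlib

section
/- Let L ≥ 2 be an integer, P > 0, and let a ∈ ℤ^L be a fixed integer vector with ‖a‖² ≥ 2 (i.e., not a signed unit vector and nonzero). Let h be a standard Gaussian random vector in ℝ^L. Then the probability that a achieves a value of f at most that of every standard basis vector satisfies P( f(a) ≤ min_{1≤i≤L} f(e_i) ) ≤ 1 − I_{Φ(a)}(1/2, (L−1)/2), where Φ(a) = 1 − 1/‖a‖² and I_x(α,β) denotes the cumulative distribution function at x of the Beta(α,β) distribution. -/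
open MeasureTheory ProbabilityTheory Filter

/-- Squared Euclidean norm of a vector in `ℝ^L`. -/
noncomputable def sqNorm {L : ℕ} (v : Fin L → ℝ) : ℝ := ∑ i, v i ^ 2

/-- Standard inner product on `ℝ^L`. -/
noncomputable def dotp {L : ℕ} (v w : Fin L → ℝ) : ℝ := ∑ i, v i * w i

/-- The law of a standard Gaussian random vector in `ℝ^L` (i.i.d. `N(0,1)` coordinates). -/
noncomputable def gaussianPi (L : ℕ) : Measure (Fin L → ℝ) :=
  Measure.pi fun _ => gaussianReal 0 1

/-- The quadratic form `f(a) = ‖a‖² + P(‖a‖²‖h‖² − ⟨h,a⟩²) = aᵀGa`. -/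
noncomputable def fCF {L : ℕ} (P : ℝ) (h a : Fin L → ℝ) : ℝ :=
  sqNorm a + P * (sqNorm a * sqNorm h - (dotp h a) ^ 2)

/-- The `i`-th standard basis vector of `ℝ^L`. -/
noncomputable def stdBasis {L : ℕ} (i : Fin L) : Fin L → ℝ :=
  fun j => if j = i then 1 else 0

/-- `betaCDF α β x` is the CDF at `x` of the Beta distribution with parameters `α`, `β`
(the regularized incomplete Beta function `I_x(α,β)`). -/
noncomputable def betaCDF (α β x : ℝ) : ℝ :=
  ∫ t in Set.Ioc (0 : ℝ) x,
    (Real.Gamma (α + β) / (Real.Gamma α * Real.Gamma β)) * t ^ (α - 1) * (1 - t) ^ (β - 1)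


open scoped ENNReal NNReal

theorem pi_withDensity_eq {ι : Type*} [Fintype ι] {X : ι → Type*} [∀ i, MeasurableSpace (X i)]
    (μ : ∀ i, Measure (X i)) [∀ i, IsProbabilityMeasure (μ i)] (f : ∀ i, X i → ℝ≥0∞)
    (hf : ∀ i, Measurable (f i)) [∀ i, SigmaFinite ((μ i).withDensity (f i))] :
    Measure.pi (fun i => (μ i).withDensity (f i)) =
      (Measure.pi μ).withDensity fun x => ∏ i, f i (x i) := by
  refine Measure.pi_eq fun s hs => ?_
  have hbox : (Set.univ.pi s).indicator (fun x : ∀ i, X i => ∏ i, f i (x i)) =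
      fun x => ∏ i, (s i).indicator (f i) (x i) := by
    funext x
    by_cases hx : x ∈ Set.univ.pi s
    · rw [Set.indicator_of_mem hx]
      exact Finset.prod_congr rfl fun i _ => (Set.indicator_of_mem (hx i trivial) _).symm
    · rw [Set.indicator_of_notMem hx]
      obtain ⟨i, hi⟩ : ∃ i, x i ∉ s i := by simpa [Set.mem_pi] using hx
      exact (Finset.prod_eq_zero (Finset.mem_univ i) (Set.indicator_of_notMem hi _)).symm
  rw [withDensity_apply _ (MeasurableSet.univ_pi hs),
    ← lintegral_indicator (MeasurableSet.univ_pi hs), hbox]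
  beta_reduce
  rw [
    lintegral_prod_eq_prod_lintegral_of_indepFun (Ω := ∀ i, X i) Finset.univ
      (fun i (x : ∀ i, X i) => (s i).indicator (f i) (x i))
      (iIndepFun_pi fun i => ((hf i).indicator (hs i)).aemeasurable)
      (fun i => ((hf i).indicator (hs i)).comp (measurable_pi_apply i))]
  refine Finset.prod_congr rfl fun i _ => ?_
  rw [(measurePreserving_eval μ i).lintegral_comp ((hf i).indicator (hs i)),
    lintegral_indicator (hs i), withDensity_apply _ (hs i)]

/-- Exponential tilting of the standard Gaussian by `exp (-s² x² / 2)` amounts to rescaling. -/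
theorem gaussianReal_withDensity_exp_neg_sq (s : ℝ) :
    (gaussianReal 0 1).withDensity
        (fun x => ENNReal.ofReal (√(1 + s ^ 2) * Real.exp (-(s ^ 2 * x ^ 2 / 2)))) =
      (gaussianReal 0 1).map ((√(1 + s ^ 2))⁻¹ * ·) := by
  have hs : 0 < 1 + s ^ 2 := by positivity
  have hk : √(1 + s ^ 2) ≠ 0 := (Real.sqrt_pos.2 hs).ne'
  rw [gaussianReal_map_const_mul, gaussianReal_of_var_ne_zero _ one_ne_zero,
    gaussianReal_of_var_ne_zero, ← withDensity_mul]
  · congr 1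
    funext x
    simp only [gaussianPDF, gaussianPDFReal, Pi.mul_apply]
    rw [← ENNReal.ofReal_mul (by positivity)]
    congr 1
    simp only [mul_zero, sub_zero, mul_one, NNReal.coe_one, NNReal.coe_mk]
    rw [inv_pow, Real.sq_sqrt hs.le, Real.sqrt_mul (x := 2 * Real.pi) (by positivity),
      Real.sqrt_inv, mul_inv, inv_inv,
      mul_mul_mul_comm, ← Real.exp_add]
    congr 2
    field_simp
    ring
  · fun_prop
  · fun_prop
  · rw [← NNReal.coe_ne_zero]
    simpa using hk

theorem gaussianPi_withDensity (d : ℕ) (s : ℝ) :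
    (gaussianPi d).withDensity
        (fun y => ENNReal.ofReal (√(1 + s ^ 2) ^ d * Real.exp (-(s ^ 2 * sqNorm y / 2)))) =
      (gaussianPi d).map ((√(1 + s ^ 2))⁻¹ • ·) := by
  have h := pi_withDensity_eq (fun _ : Fin d => gaussianReal 0 1)
    (fun _ x => ENNReal.ofReal (√(1 + s ^ 2) * Real.exp (-(s ^ 2 * x ^ 2 / 2))))
    (fun _ => by fun_prop)
  have hmap := Measure.pi_map_pi (μ := fun _ : Fin d => gaussianReal 0 1)
    (f := fun _ => ((√(1 + s ^ 2))⁻¹ * ·)) (fun _ => by fun_prop)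
  simp only [gaussianReal_withDensity_exp_neg_sq] at h
  rw [← hmap] at h
  unfold gaussianPi
  refine Eq.trans ?_ h.symm
  congr 1
  funext y
  rw [← ENNReal.ofReal_prod_of_nonneg fun i _ => by positivity]
  rw [Finset.prod_mul_distrib, ← Real.exp_sum]
  simp [sqNorm, Finset.mul_sum, Finset.sum_div]

/-- The density of the Student-type law of the ratio of a Gaussian coordinate and the norm of
an independent `d`-dimensional Gaussian vector, up to normalization. -/
noncomputable def ratioDensity (d : ℕ) (s : ℝ) : ℝ≥0∞ :=
  ENNReal.ofReal ((√(1 + s ^ 2) ^ (d + 1))⁻¹)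

theorem measurable_ratioDensity (d : ℕ) : Measurable (ratioDensity d) := by
  unfold ratioDensity
  fun_prop

theorem measurable_sqNorm {L : ℕ} : Measurable (sqNorm (L := L)) := by
  unfold sqNorm
  fun_prop

instance (L : ℕ) : IsProbabilityMeasure (gaussianPi L) := by
  unfold gaussianPi
  infer_instance

theorem lintegral_norm_mul_gaussianPDF (d : ℕ) (s : ℝ) :
    ∫⁻ y, ENNReal.ofReal (√(sqNorm y)) * gaussianPDF 0 1 (s * √(sqNorm y)) ∂gaussianPi d =
      (ENNReal.ofReal (√(2 * Real.pi))⁻¹ * ∫⁻ y, ENNReal.ofReal (√(sqNorm y)) ∂gaussianPi d) *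
        ratioDensity d s := by
  have hs : 0 < 1 + s ^ 2 := by positivity
  set k := √(1 + s ^ 2) with hk
  have hk0 : 0 < k := Real.sqrt_pos.2 hs
  have hnn (y : Fin d → ℝ) : 0 ≤ sqNorm y := Finset.sum_nonneg fun i _ => sq_nonneg _
  have hm := measurable_sqNorm (L := d)
  have h1 (y : Fin d → ℝ) :
      ENNReal.ofReal (√(sqNorm y)) * gaussianPDF 0 1 (s * √(sqNorm y)) =
      ENNReal.ofReal ((√(2 * Real.pi))⁻¹ * (k ^ d)⁻¹) *
        (ENNReal.ofReal (k ^ d * Real.exp (-(s ^ 2 * sqNorm y / 2))) *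
          ENNReal.ofReal (√(sqNorm y))) := by
    simp only [gaussianPDF, gaussianPDFReal]
    rw [← ENNReal.ofReal_mul (by positivity), ← ENNReal.ofReal_mul (by positivity),
      ← ENNReal.ofReal_mul (by positivity)]
    congr 1
    simp only [sub_zero, NNReal.coe_one, mul_one, mul_pow, Real.sq_sqrt (hnn y), neg_div]
    field_simp
  have hscale (y : Fin d → ℝ) : √(sqNorm (k⁻¹ • y)) = k⁻¹ * √(sqNorm y) := by
    have : sqNorm (k⁻¹ • y) = (k⁻¹) ^ 2 * sqNorm y := by
      simp [sqNorm, Finset.mul_sum, mul_pow]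
    rw [this, Real.sqrt_mul (by positivity), Real.sqrt_sq (by positivity)]
  simp_rw [h1]
  rw [lintegral_const_mul _ (by fun_prop)]
  have h2 := lintegral_withDensity_eq_lintegral_mul (gaussianPi d)
    (f := fun y => ENNReal.ofReal (k ^ d * Real.exp (-(s ^ 2 * sqNorm y / 2)))) (by fun_prop)
    (g := fun y => ENNReal.ofReal (√(sqNorm y))) (by fun_prop)
  simp only [Pi.mul_apply] at h2
  rw [← h2, gaussianPi_withDensity, lintegral_map (by fun_prop) (by fun_prop), ← hk]
  simp_rw [hscale, ENNReal.ofReal_mul (inv_nonneg.2 hk0.le)]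
  rw [lintegral_const_mul _ (by fun_prop), ratioDensity, ← hk, pow_succ, mul_inv,
    ENNReal.ofReal_mul (by positivity), ENNReal.ofReal_mul (by positivity)]
  ring

theorem gaussianReal_preimage_div {r : ℝ} (hr : 0 < r) {S : Set ℝ} (hS : MeasurableSet S) :
    gaussianReal 0 1 {x | x / r ∈ S} =
      ∫⁻ s in S, ENNReal.ofReal r * gaussianPDF 0 1 (s * r) := by
  have himage : {x | x / r ∈ S} = (· * r) '' S := by
    ext x
    constructor
    · exact fun hx => ⟨x / r, hx, div_mul_cancel₀ x hr.ne'⟩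
    · rintro ⟨y, hy, rfl⟩
      simpa [hr.ne'] using hy
  rw [gaussianReal_apply _ one_ne_zero, himage,
    lintegral_image_eq_lintegral_abs_deriv_mul hS (f' := fun _ => r)
      (fun x _ => by simpa using ((hasDerivAt_id x).mul_const r).hasDerivWithinAt)
      (mul_left_injective₀ hr.ne').injOn]
  simp [abs_of_pos hr]

theorem ae_sqNorm_pos {d : ℕ} (hd : 1 ≤ d) : ∀ᵐ y ∂gaussianPi d, 0 < sqNorm y := by
  have : NullSingletonClass (gaussianReal 0 1) := nullSingletonClass_gaussianReal one_ne_zero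
  have h := (measurePreserving_eval (fun _ : Fin d => gaussianReal 0 1)
    ⟨0, hd⟩).quasiMeasurePreserving.ae (p := fun x => x ≠ 0) (Measure.ae_ne _ 0)
  filter_upwards [h] with y hy
  exact Finset.sum_pos' (fun i _ => sq_nonneg _) ⟨_, Finset.mem_univ _, by positivity⟩

theorem exists_prod_gaussianPi_ratio {d : ℕ} (hd : 1 ≤ d) :
    ∃ K : ℝ≥0∞, ∀ S : Set ℝ, MeasurableSet S →
      ((gaussianReal 0 1).prod (gaussianPi d)) {p | p.1 / √(sqNorm p.2) ∈ S} =
        K * ∫⁻ s in S, ratioDensity d s := by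
  refine ⟨ENNReal.ofReal (√(2 * Real.pi))⁻¹ * ∫⁻ y, ENNReal.ofReal (√(sqNorm y)) ∂gaussianPi d,
    fun S hS => ?_⟩
  have hm := measurable_sqNorm (L := d)
  have hms : MeasurableSet {p : ℝ × (Fin d → ℝ) | p.1 / √(sqNorm p.2) ∈ S} :=
    measurableSet_preimage (by fun_prop) hS
  rw [Measure.prod_apply_symm hms]
  have hpt : ∀ᵐ y ∂gaussianPi d,
      gaussianReal 0 1 ((fun x => (x, y)) ⁻¹' {p | p.1 / √(sqNorm p.2) ∈ S}) =
        ∫⁻ s in S, ENNReal.ofReal (√(sqNorm y)) * gaussianPDF 0 1 (s * √(sqNorm y)) := by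
    filter_upwards [ae_sqNorm_pos hd] with y hy
    exact gaussianReal_preimage_div (Real.sqrt_pos.2 hy) hS
  rw [lintegral_congr_ae hpt, lintegral_lintegral_swap (by fun_prop)]
  simp_rw [lintegral_norm_mul_gaussianPDF]
  rw [lintegral_const_mul _ (measurable_ratioDensity d)]

theorem lintegral_image_betaPDF (d : ℕ) {T : Set ℝ} (hT : MeasurableSet T)
    (hT0 : T ⊆ Set.Ioi 0) :
    ∫⁻ t in (fun s : ℝ => s ^ 2 / (1 + s ^ 2)) '' T, betaPDF (1 / 2) (d / 2) t =
      ENNReal.ofReal (2 / beta (1 / 2) (d / 2)) * ∫⁻ s in T, ratioDensity d s := by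
  have hderiv (s : ℝ) :
      HasDerivAt (fun s : ℝ => s ^ 2 / (1 + s ^ 2)) (2 * s / (1 + s ^ 2) ^ 2) s := by
    have h := (hasDerivAt_pow 2 s).div ((hasDerivAt_pow 2 s).const_add 1)
      (by positivity : 1 + s ^ 2 ≠ 0)
    refine h.congr_deriv ?_
    push_cast
    ring
  have hinj : Set.InjOn (fun s : ℝ => s ^ 2 / (1 + s ^ 2)) T := by
    intro s hs t ht hst
    have hs0 : 0 < s := hT0 hs
    have ht0 : 0 < t := hT0 ht
    have h : s ^ 2 / (1 + s ^ 2) = t ^ 2 / (1 + t ^ 2) := hst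
    rw [div_eq_div_iff (by positivity) (by positivity)] at h
    exact (pow_left_inj₀ hs0.le ht0.le two_ne_zero).1 (by linarith)
  rw [lintegral_image_eq_lintegral_abs_deriv_mul hT
      (fun s _ => (hderiv s).hasDerivWithinAt) hinj,
    ← lintegral_const_mul _ (measurable_ratioDensity d)]
  refine setLIntegral_congr_fun hT fun s hs => ?_
  have hs0 : 0 < s := hT0 hs
  have hq : 0 < √(1 + s ^ 2) := Real.sqrt_pos.2 (by positivity)
  have hq2 : 1 + s ^ 2 = √(1 + s ^ 2) ^ 2 := (Real.sq_sqrt (by positivity)).symm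
  have hlt : s ^ 2 / (1 + s ^ 2) < 1 := by
    rw [div_lt_one (by positivity)]
    linarith
  have h1 : (s ^ 2 / (1 + s ^ 2)) ^ ((1 : ℝ) / 2 - 1) = √(1 + s ^ 2) / s := by
    rw [show ((1 : ℝ) / 2 - 1) = -(1 / 2) by norm_num, Real.rpow_neg (by positivity),
      ← Real.sqrt_eq_rpow, Real.sqrt_div (by positivity), Real.sqrt_sq hs0.le, inv_div]
  have h2 : (1 - s ^ 2 / (1 + s ^ 2)) ^ ((d : ℝ) / 2 - 1) =
      √(1 + s ^ 2) ^ 2 / √(1 + s ^ 2) ^ d := by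
    have : 1 - s ^ 2 / (1 + s ^ 2) = √(1 + s ^ 2) ^ (-2 : ℝ) := by
      rw [Real.rpow_neg hq.le, Real.rpow_two, ← hq2]
      field_simp
      ring
    rw [this, ← Real.rpow_mul hq.le, show (-2 : ℝ) * ((d : ℝ) / 2 - 1) = 2 - d by ring,
      Real.rpow_sub hq, Real.rpow_natCast, Real.rpow_two]
  simp only [betaPDF_of_pos_lt_one (by positivity : 0 < s ^ 2 / (1 + s ^ 2)) hlt, ratioDensity]
  rw [← ENNReal.ofReal_mul (abs_nonneg _), h1, h2, abs_of_pos (by positivity),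
    mul_comm, ← ENNReal.ofReal_mul' (by positivity)]
  congr 1
  rw [show (1 + s ^ 2) ^ 2 = √(1 + s ^ 2) ^ 4 by nth_rewrite 1 [hq2]; ring]
  field_simp
  rw [pow_succ']

theorem image_sq_div_Ioi :
    (fun s : ℝ => s ^ 2 / (1 + s ^ 2)) '' Set.Ioi 0 = Set.Ioo 0 1 := by
  ext t
  constructor
  · rintro ⟨s, hs, rfl⟩
    have hs0 : 0 < s := hs
    refine ⟨by positivity, ?_⟩
    rw [div_lt_one (by positivity)]
    linarith
  · rintro ⟨h0, h1⟩
    have h1' : 0 < 1 - t := by linarith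
    refine ⟨√(t / (1 - t)), Real.sqrt_pos.2 (by positivity), ?_⟩
    simp only [Real.sq_sqrt (div_pos h0 h1').le]
    field_simp
    ring

theorem image_sq_div_Ioo {c : ℝ} (hc : 0 < c) :
    (fun s : ℝ => s ^ 2 / (1 + s ^ 2)) '' Set.Ioo 0 (√c) = Set.Ioo 0 (c / (1 + c)) := by
  have key {s : ℝ} (hs : 0 < s) : s ^ 2 / (1 + s ^ 2) < c / (1 + c) ↔ s < √c := by
    rw [Real.lt_sqrt hs.le, div_lt_div_iff₀ (by positivity) (by positivity)]
    constructor <;> intro h <;> linarith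
  ext t
  constructor
  · rintro ⟨s, ⟨hs0, hs⟩, rfl⟩
    exact ⟨by positivity, (key hs0).2 hs⟩
  · rintro ⟨h0, h1⟩
    have hlt : t < 1 := h1.trans ((div_lt_one (by positivity)).2 (by linarith))
    obtain ⟨s, hs, rfl⟩ : t ∈ (fun s : ℝ => s ^ 2 / (1 + s ^ 2)) '' Set.Ioi 0 :=
      image_sq_div_Ioi ▸ ⟨h0, hlt⟩
    exact ⟨s, ⟨hs, (key hs).1 h1⟩, rfl⟩

theorem setLIntegral_abs_preimage {g : ℝ → ℝ≥0∞} (hg : Measurable g) (heven : ∀ x, g (-x) = g x)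
    {T : Set ℝ} (hT : MeasurableSet T) (hT0 : T ⊆ Set.Ioi 0) :
    ∫⁻ s in {s | |s| ∈ T}, g s = 2 * ∫⁻ s in T, g s := by
  have hset : {s : ℝ | |s| ∈ T} = T ∪ Neg.neg ⁻¹' T := by
    ext s
    rcases lt_trichotomy s 0 with hs | rfl | hs
    · have : s ∉ T := fun h => hs.not_gt (hT0 h)
      simp [abs_of_neg hs, this]
    · simp
    · have : -s ∉ T := fun h => by linarith [show 0 < -s from hT0 h]
      simp [abs_of_pos hs, this]
  have hdisj : Disjoint T (Neg.neg ⁻¹' T) :=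
    Set.disjoint_left.2 fun s hs hs' => by
      linarith [show 0 < s from hT0 hs, show 0 < -s from hT0 hs']
  have hneg : ∫⁻ s in Neg.neg ⁻¹' T, g s = ∫⁻ s in T, g s := by
    simpa [heven] using
      (Measure.measurePreserving_neg (volume : Measure ℝ)).setLIntegral_comp_preimage hT hg
  rw [hset, lintegral_union (measurable_neg hT) hdisj, hneg, two_mul]

theorem prod_gaussianPi_abs_ratio_lt {d : ℕ} (hd : 1 ≤ d) {c : ℝ} (hc : 0 < c) :
    ((gaussianReal 0 1).prod (gaussianPi d)) {p | |p.1 / √(sqNorm p.2)| ∈ Set.Ioo 0 (√c)} =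
      ∫⁻ t in Set.Ioo 0 (c / (1 + c)), betaPDF (1 / 2) (d / 2) t := by
  obtain ⟨K, hK⟩ := exists_prod_gaussianPi_ratio hd
  have hd0 : (0 : ℝ) < d / 2 := by positivity
  have heven (x : ℝ) : ratioDensity d (-x) = ratioDensity d x := by simp [ratioDensity]
  have hratio {T : Set ℝ} (hT : MeasurableSet T) (hT0 : T ⊆ Set.Ioi 0) :
      ((gaussianReal 0 1).prod (gaussianPi d)) {p | |p.1 / √(sqNorm p.2)| ∈ T} =
        K * 2 * ∫⁻ s in T, ratioDensity d s := by
    rw [mul_assoc, ← setLIntegral_abs_preimage (measurable_ratioDensity d) heven hT hT0]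
    exact hK {s | |s| ∈ T} (measurableSet_preimage (by fun_prop) hT)
  have hone : K * 2 * ∫⁻ s in Set.Ioi 0, ratioDensity d s = 1 := by
    have huniv := hK Set.univ MeasurableSet.univ
    have hne : ({s : ℝ | |s| ∈ Set.Ioi 0} : Set ℝ) =ᵐ[volume] Set.univ := by
      have : ∀ᵐ s : ℝ, s ≠ 0 := Measure.ae_ne _ 0
      filter_upwards [this] with s hs
      exact propext (iff_of_true (abs_pos.2 hs) trivial)
    rw [← setLIntegral_congr hne, setLIntegral_abs_preimage (measurable_ratioDensity d) heven
      measurableSet_Ioi subset_rfl, ← mul_assoc] at huniv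
    simpa using huniv.symm
  have hbeta : ENNReal.ofReal (2 / beta (1 / 2) (d / 2)) *
      ∫⁻ s in Set.Ioi 0, ratioDensity d s = 1 := by
    rw [← lintegral_image_betaPDF d measurableSet_Ioi subset_rfl, image_sq_div_Ioi,
      ← lintegral_betaPDF_eq_one (one_half_pos (α := ℝ)) hd0, lintegral_betaPDF]
    exact setLIntegral_congr_fun measurableSet_Ioo fun t ht => betaPDF_of_pos_lt_one ht.1 ht.2
  rw [hratio measurableSet_Ioo Set.Ioo_subset_Ioi_self, ENNReal.eq_inv_of_mul_eq_one_left hone,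
    ← ENNReal.eq_inv_of_mul_eq_one_left hbeta,
    ← lintegral_image_betaPDF d measurableSet_Ioo Set.Ioo_subset_Ioi_self, image_sq_div_Ioo hc]

theorem betaCDF_eq_toReal_lintegral {α β x : ℝ} (hα : 0 < α) (hβ : 0 < β) (hx : x < 1) :
    betaCDF α β x = (∫⁻ t in Set.Ioo 0 x, betaPDF α β t).toReal := by
  have hpos : ∀ t ∈ Set.Ioo 0 x, 0 ≤ betaPDFReal α β t := fun t ht =>
    (betaPDFReal_pos ht.1 (ht.2.trans hx) hα hβ).le
  rw [betaCDF, integral_Ioc_eq_integral_Ioo]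
  simp only [betaPDF]
  rw [← integral_eq_lintegral_of_nonneg_ae (ae_restrict_of_forall_mem measurableSet_Ioo hpos)
    (stronglyMeasurable_betaPDFReal α β).aestronglyMeasurable]
  refine setIntegral_congr_fun measurableSet_Ioo fun t ht => ?_
  simp [betaPDFReal, ht.1, ht.2.trans hx, beta]

theorem gaussianPi_le_mul_sq_zero {d : ℕ} (hd : 1 ≤ d) {c : ℝ} (hc : 0 < c) :
    gaussianPi (d + 1) {h | c * sqNorm h ≤ (1 + c) * h 0 ^ 2} ≤
      1 - ∫⁻ t in Set.Ioo 0 (c / (1 + c)), betaPDF (1 / 2) (d / 2) t := by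
  have hm := measurable_sqNorm (L := d)
  have hmp : MeasurePreserving (MeasurableEquiv.piFinSuccAbove (fun _ : Fin (d + 1) => ℝ) 0)
      (gaussianPi (d + 1)) ((gaussianReal 0 1).prod (gaussianPi d)) :=
    measurePreserving_piFinSuccAbove (fun _ : Fin (d + 1) => gaussianReal 0 1) 0
  have hms : MeasurableSet
      {p : ℝ × (Fin d → ℝ) | |p.1 / √(sqNorm p.2)| ∈ Set.Ioo 0 (√c)} :=
    measurableSet_preimage (by fun_prop) measurableSet_Ioo
  rw [← prod_gaussianPi_abs_ratio_lt hd hc, ← prob_compl_eq_one_sub hms,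
    ← hmp.measure_preimage hms.compl.nullMeasurableSet]
  refine measure_mono_ae ?_
  have hpos : ∀ᵐ h ∂gaussianPi (d + 1), 0 < sqNorm fun j : Fin d => h j.succ := by
    have h1 : ∀ᵐ p ∂(gaussianReal 0 1).prod (gaussianPi d), 0 < sqNorm p.2 :=
      Measure.quasiMeasurePreserving_snd.ae (ae_sqNorm_pos hd)
    exact hmp.quasiMeasurePreserving.ae h1
  filter_upwards [hpos] with h hh hle hmem
  have hle' : c * sqNorm h ≤ (1 + c) * h 0 ^ 2 := hle
  have hlt : |h 0 / √(sqNorm fun j : Fin d => h j.succ)| < √c := hmem.2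
  have hsum : sqNorm h = h 0 ^ 2 + sqNorm fun j : Fin d => h j.succ := by
    simp [sqNorm, Fin.sum_univ_succ]
  rw [Real.lt_sqrt (abs_nonneg _), sq_abs, div_pow, Real.sq_sqrt hh.le, div_lt_iff₀ hh] at hlt
  rw [hsum] at hle'
  linarith

/-- Rotation invariance: the Gaussian measure of a set described by the norm of `h` and the
inner product of `h` with `v` depends on `v` only through its norm. -/
theorem gaussianPi_dotp_eq_coord {L : ℕ} (v : Fin L → ℝ) (i : Fin L) (p : ℝ → ℝ → Prop)
    (hp : MeasurableSet {q : ℝ × ℝ | p q.1 q.2}) :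
    gaussianPi L {h | p (sqNorm h) (dotp h v)} =
      gaussianPi L {h | p (sqNorm h) (√(sqNorm v) * h i)} := by
  let γ := stdGaussian (EuclideanSpace ℝ (Fin L))
  have hγ : (gaussianPi L).map (WithLp.toLp 2) = γ := map_pi_eq_stdGaussian
  have hnorm (h : Fin L → ℝ) : sqNorm h = ‖WithLp.toLp 2 h‖ ^ 2 := by
    rw [EuclideanSpace.real_norm_sq_eq, sqNorm]
  have hdot (h w : Fin L → ℝ) : dotp h w = inner ℝ (WithLp.toLp 2 h) (WithLp.toLp 2 w) := by
    simp [dotp, PiLp.inner_apply, mul_comm]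
  have hset (w : EuclideanSpace ℝ (Fin L)) :
      MeasurableSet {x : EuclideanSpace ℝ (Fin L) | p (‖x‖ ^ 2) (inner ℝ x w)} :=
    measurableSet_preimage (f := fun x => (‖x‖ ^ 2, inner ℝ x w)) (by fun_prop) hp
  have htransfer (w : EuclideanSpace ℝ (Fin L)) :
      gaussianPi L {h | p (‖WithLp.toLp 2 h‖ ^ 2) (inner ℝ (WithLp.toLp 2 h) w)} =
        γ {x | p (‖x‖ ^ 2) (inner ℝ x w)} := by
    rw [← hγ, Measure.map_apply (by fun_prop) (hset w)]
    rfl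
  let w : EuclideanSpace ℝ (Fin L) := ‖WithLp.toLp 2 v‖ • EuclideanSpace.single i 1
  have hvw : ‖WithLp.toLp 2 v‖ = ‖w‖ := by simp [w, norm_smul]
  let R := (ℝ ∙ (WithLp.toLp 2 v - w))ᗮ.reflection
  have hR : R (WithLp.toLp 2 v) = w := Submodule.reflection_sub hvw
  have hrot : γ {x | p (‖x‖ ^ 2) (inner ℝ x (WithLp.toLp 2 v))} =
      γ {x | p (‖x‖ ^ 2) (inner ℝ x w)} := by
    have hmap : γ.map R = γ := stdGaussian_map R
    conv_rhs => rw [← hmap, Measure.map_apply R.continuous.measurable (hset w)]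
    congr 1
    ext x
    simp only [Set.mem_ofPred_eq, Set.mem_preimage, R.norm_map]
    rw [← hR, R.inner_map_map]
  have hw (h : Fin L → ℝ) : √(sqNorm v) * h i = inner ℝ (WithLp.toLp 2 h) w := by
    rw [hnorm, Real.sqrt_sq (norm_nonneg _)]
    simp [w, inner_smul_right, EuclideanSpace.inner_single_right]
  simp_rw [hw, hdot, hnorm]
  rw [htransfer, htransfer, hrot]

theorem mul_sqNorm_le_dotp_sq_of_fCF_le {L : ℕ} {P : ℝ} (hP : 0 < P) {h v : Fin L → ℝ}
    (hv : 1 ≤ sqNorm v) (i : Fin L) (hle : fCF P h v ≤ fCF P h (stdBasis i)) :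
    (sqNorm v - 1) * sqNorm h ≤ dotp h v ^ 2 := by
  have hs : sqNorm (stdBasis i) = 1 := by simp [sqNorm, stdBasis]
  have hd : dotp h (stdBasis i) = h i := by simp [dotp, stdBasis]
  simp only [fCF, hs, hd] at hle
  refine le_of_mul_le_mul_left ?_ hP
  nlinarith [mul_nonneg hP.le (sq_nonneg (h i))]

/-- For a fixed integer vector `a` with `‖a‖² ≥ 2` (nonzero and not a signed unit vector),
the probability that `f(a) ≤ min_i f(e_i)` under a standard Gaussian channel `h` is at most
`1 − I_{Φ(a)}(1/2, (L−1)/2)` with `Φ(a) = 1 − 1/‖a‖²`. -/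
theorem statement0 (L : ℕ) (hL : 2 ≤ L) (P : ℝ) (hP : 0 < P)
    (a : Fin L → ℤ) (ha : 2 ≤ sqNorm (fun i => (a i : ℝ))) :
    gaussianPi L {h | ∀ i : Fin L,
        fCF P h (fun j => (a j : ℝ)) ≤ fCF P h (stdBasis i)}
      ≤ ENNReal.ofReal
          (1 - betaCDF (1 / 2) (((L : ℝ) - 1) / 2)
                (1 - 1 / sqNorm (fun i => (a i : ℝ)))) := by
  obtain ⟨d, rfl⟩ : ∃ d, L = d + 1 := ⟨L - 1, by omega⟩
  have hd : 1 ≤ d := by omega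
  set v : Fin (d + 1) → ℝ := fun i => (a i : ℝ)
  have hv : 0 < sqNorm v := by linarith
  have hc : 0 < sqNorm v - 1 := by linarith
  have hΦ : 1 - 1 / sqNorm v = (sqNorm v - 1) / (1 + (sqNorm v - 1)) := by
    field_simp
    ring
  have hΦ1 : 1 - 1 / sqNorm v < 1 := by
    have := one_div_pos.2 hv
    linarith
  have hβ : (0 : ℝ) < d / 2 := by positivity
  have hdim : (((d + 1 : ℕ) : ℝ) - 1) / 2 = d / 2 := by push_cast; ring
  have hfin : ∫⁻ t in Set.Ioo 0 (1 - 1 / sqNorm v), betaPDF (1 / 2) (d / 2) t ≠ ∞ :=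
    ne_top_of_le_ne_top ENNReal.one_ne_top
      ((setLIntegral_le_lintegral _ _).trans_eq
        (lintegral_betaPDF_eq_one (one_half_pos (α := ℝ)) hβ))
  rw [hdim, betaCDF_eq_toReal_lintegral one_half_pos hβ hΦ1,
    ENNReal.ofReal_sub _ ENNReal.toReal_nonneg, ENNReal.ofReal_one, ENNReal.ofReal_toReal hfin, hΦ]
  calc gaussianPi (d + 1) {h | ∀ i, fCF P h v ≤ fCF P h (stdBasis i)}
      ≤ gaussianPi (d + 1) {h | (sqNorm v - 1) * sqNorm h ≤ dotp h v ^ 2} :=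
        measure_mono fun h hle => mul_sqNorm_le_dotp_sq_of_fCF_le hP (by linarith) 0 (hle 0)
    _ = gaussianPi (d + 1)
          {h | (sqNorm v - 1) * sqNorm h ≤ (1 + (sqNorm v - 1)) * h 0 ^ 2} := by
        rw [gaussianPi_dotp_eq_coord v 0 (fun r t => (sqNorm v - 1) * r ≤ t ^ 2)
          (measurableSet_le (by fun_prop) (by fun_prop))]
        simp_rw [mul_pow, Real.sq_sqrt hv.le, add_sub_cancel]
    _ ≤ _ := gaussianPi_le_mul_sq_zero hd hc
end

section
/- Let L ≥ 4 be an integer, P > 0, and let a ∈ ℤ^L be a fixed integer vector with ‖a‖² ≥ 2. Let h be a standard Gaussian random vector in ℝ^L. Then P( f(a) ≤ min_{1≤i≤L} f(e_i) ) ≤ (1/‖a‖²)^{⌊L/2⌋ − 1} ≤ ‖a‖^{−(L−3)} = e^{−L E₁(L)}, where E₁(L) = (1 − 3/L)·ln‖a‖ > 0. -/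
open MeasureTheory ProbabilityTheory Filter

lemma lintegral_rayleigh_tail (t : ℝ) (ht : 0 ≤ t) :
    ∫⁻ r in Set.Ici (√t), ENNReal.ofReal (r * Real.exp (-r ^ 2 / 2)) =
      ENNReal.ofReal (Real.exp (-t / 2)) := by
  have hd : ∀ x ∈ Set.Ici (√t), HasDerivAt (fun r : ℝ => -Real.exp (-r ^ 2 / 2))
      (x * Real.exp (-x ^ 2 / 2)) x := by
    intro x _
    refine (((hasDerivAt_pow 2 x).neg.div_const 2).exp).neg.congr_deriv ?_
    rw [Pi.neg_apply]
    push_cast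
    ring
  have hpos : ∀ x ∈ Set.Ioi (√t), 0 ≤ x * Real.exp (-x ^ 2 / 2) := fun x hx =>
    mul_nonneg ((Real.sqrt_nonneg t).trans (le_of_lt hx)) (Real.exp_pos _).le
  have hlim : Tendsto (fun r : ℝ => -Real.exp (-r ^ 2 / 2)) atTop (nhds 0) := by
    rw [← neg_zero]
    refine (Real.tendsto_exp_atBot.comp ?_).neg
    have : Tendsto (fun r : ℝ => r ^ 2 / 2) atTop atTop :=
      (tendsto_pow_atTop two_ne_zero).atTop_div_const two_pos
    refine (tendsto_neg_atTop_atBot.comp this).congr fun r => ?_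
    simp [neg_div]
  rw [setLIntegral_congr Ioi_ae_eq_Ici.symm,
    ← ofReal_integral_eq_lintegral_ofReal (integrableOn_Ioi_deriv_of_nonneg' hd hpos hlim)
      (ae_restrict_of_forall_mem measurableSet_Ioi hpos),
    integral_Ioi_of_hasDerivAt_of_nonneg' hd hpos hlim, Real.sq_sqrt ht]
  simp

lemma integral_exp_neg_sum_sq_pi_gaussian (n : ℕ) (c : ℝ) (hc : 0 ≤ c) :
    ∫ x : Fin n → ℝ, Real.exp (-(c * ∑ i, x i ^ 2) / 2)
      ∂(Measure.pi fun _ => gaussianReal 0 1) = (√(1 + c))⁻¹ ^ n := by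
  have h1 : ∫ x, Real.exp (-(c * x ^ 2) / 2) ∂(gaussianReal 0 1) = (√(1 + c))⁻¹ := by
    rw [integral_gaussianReal_eq_integral_smul one_ne_zero]
    have (x : ℝ) : gaussianPDFReal 0 1 x • Real.exp (-(c * x ^ 2) / 2) =
        (√(2 * Real.pi))⁻¹ * Real.exp (-((1 + c) / 2) * x ^ 2) := by
      simp only [gaussianPDFReal, smul_eq_mul, mul_assoc, ← Real.exp_add]
      simp only [sub_zero, NNReal.coe_one, mul_one]
      congr 3
      ring
    simp_rw [this]
    rw [integral_const_mul, integral_gaussian, ← Real.sqrt_inv, ← Real.sqrt_inv,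
      ← Real.sqrt_mul (by positivity)]
    congr 1
    field_simp
  calc _ = ∫ x : Fin n → ℝ, ∏ i, Real.exp (-(c * x i ^ 2) / 2)
      ∂(Measure.pi fun _ => gaussianReal 0 1) := by
        simp_rw [← Real.exp_sum, Finset.mul_sum, ← Finset.sum_neg_distrib, Finset.sum_div]
    _ = _ := by
      rw [integral_fintype_prod_eq_prod (f := fun _ (x : ℝ) => Real.exp (-(c * x ^ 2) / 2)), h1]
      simp

lemma lintegral_gaussianReal_prod (F : ℝ × ℝ → ENNReal) (hF : Measurable F) :
    ∫⁻ p, F p ∂((gaussianReal 0 1).prod (gaussianReal 0 1)) =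
      ∫⁻ p : ℝ × ℝ, ENNReal.ofReal ((2 * Real.pi)⁻¹ * Real.exp (-(p.1 ^ 2 + p.2 ^ 2) / 2)) * F p := by
  have hpdf : Measurable (gaussianPDF 0 1) := measurable_gaussianPDF 0 1
  rw [lintegral_prod _ hF.aemeasurable, gaussianReal_of_var_ne_zero 0 one_ne_zero,
    lintegral_withDensity_eq_lintegral_mul _ hpdf (by fun_prop), Measure.volume_eq_prod,
    lintegral_prod _ (by fun_prop)]
  refine lintegral_congr fun x => ?_
  rw [Pi.mul_apply, lintegral_withDensity_eq_lintegral_mul _ hpdf (by fun_prop),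
    ← lintegral_const_mul _ (by fun_prop)]
  refine lintegral_congr fun y => ?_
  rw [Pi.mul_apply, ← mul_assoc, gaussianPDF, gaussianPDF,
    ← ENNReal.ofReal_mul (gaussianPDFReal_nonneg _ _ _)]
  congr 2
  simp only [gaussianPDFReal, sub_zero, NNReal.coe_one, mul_one]
  rw [mul_mul_mul_comm, ← Real.exp_add, ← mul_inv, Real.mul_self_sqrt (by positivity)]
  congr 2
  ring

lemma gaussianReal_prod_le_add_sq (t : ℝ) (ht : 0 ≤ t) :
    ((gaussianReal 0 1).prod (gaussianReal 0 1)) {p : ℝ × ℝ | t ≤ p.1 ^ 2 + p.2 ^ 2} =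
      ENNReal.ofReal (Real.exp (-t / 2)) := by
  have hS : MeasurableSet {p : ℝ × ℝ | t ≤ p.1 ^ 2 + p.2 ^ 2} :=
    measurableSet_le (by fun_prop) (by fun_prop)
  rw [← lintegral_indicator_one hS,
    lintegral_gaussianReal_prod _ (measurable_one.indicator hS),
    ← lintegral_comp_polarCoord_symm, ← lintegral_rayleigh_tail t ht]
  have hpt (p : ℝ × ℝ) (hp : p ∈ polarCoord.target) :
      ENNReal.ofReal p.1 • (ENNReal.ofReal ((2 * Real.pi)⁻¹ *
          Real.exp (-((polarCoord.symm p).1 ^ 2 + (polarCoord.symm p).2 ^ 2) / 2)) *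
        {p : ℝ × ℝ | t ≤ p.1 ^ 2 + p.2 ^ 2}.indicator 1 (polarCoord.symm p)) =
      (Set.Ici (√t)).indicator (fun r => ENNReal.ofReal (r * Real.exp (-r ^ 2 / 2))) p.1 *
        ENNReal.ofReal (2 * Real.pi)⁻¹ := by
    have hr : 0 < p.1 := hp.1
    have hsq : (polarCoord.symm p).1 ^ 2 + (polarCoord.symm p).2 ^ 2 = p.1 ^ 2 := by
      simp only [polarCoord_symm_apply]
      linear_combination p.1 ^ 2 * Real.sin_sq_add_cos_sq p.2
    have hmem : t ≤ p.1 ^ 2 ↔ √t ≤ p.1 := (Real.sqrt_le_left hr.le).symm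
    simp only [Set.indicator_apply, Set.mem_ofPred_eq, Set.mem_Ici, hsq, hmem, Pi.one_apply,
      smul_eq_mul]
    split_ifs
    · rw [mul_one, ← ENNReal.ofReal_mul hr.le, ← ENNReal.ofReal_mul (by positivity)]
      congr 1
      ring
    · simp
  rw [setLIntegral_congr_fun polarCoord.open_target.measurableSet hpt, polarCoord_target,
    Measure.volume_eq_prod, setLIntegral_prod _ (by
      refine Measurable.aemeasurable (Measurable.mul_const ?_ _)
      exact (Measurable.indicator (by fun_prop) measurableSet_Ici).comp measurable_fst)]
  have hvol : ENNReal.ofReal (2 * Real.pi)⁻¹ * volume (Set.Ioo (-Real.pi) Real.pi) = 1 := by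
    rw [Real.volume_Ioo, ← ENNReal.ofReal_mul (by positivity), ← ENNReal.ofReal_one]
    congr 1
    field_simp
    ring
  simp only [setLIntegral_const, mul_assoc, hvol, mul_one]
  rw [setLIntegral_indicator measurableSet_Ici]
  rcases ht.eq_or_lt with rfl | ht
  · rw [Real.sqrt_zero, Set.inter_eq_right.2 Set.Ioi_subset_Ici_self]
    exact setLIntegral_congr Ioi_ae_eq_Ici
  · have hsub : Set.Ici (√t) ⊆ Set.Ioi 0 := fun r hr => (Real.sqrt_pos.2 ht).trans_le hr
    rw [Set.inter_eq_left.2 hsub]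

lemma gaussianReal_prod_prod_pi_le (n : ℕ) (c : ℝ) (hc : 0 ≤ c) :
    (((gaussianReal 0 1).prod (gaussianReal 0 1)).prod
        (Measure.pi fun _ : Fin n => gaussianReal 0 1))
      {q | c * ∑ i, q.2 i ^ 2 ≤ q.1.1 ^ 2 + q.1.2 ^ 2} =
      ENNReal.ofReal ((√(1 + c))⁻¹ ^ n) := by
  rw [Measure.prod_apply_symm (measurableSet_le (by fun_prop) (by fun_prop)),
    ← integral_exp_neg_sum_sq_pi_gaussian n c hc, ofReal_integral_eq_lintegral_ofReal ?_
      (ae_of_all _ fun _ => (Real.exp_pos _).le)]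
  · exact lintegral_congr fun y => gaussianReal_prod_le_add_sq (c * ∑ i, y i ^ 2) (by positivity)
  · refine Integrable.of_bound (C := 1) (Measurable.aestronglyMeasurable (by fun_prop)) (ae_of_all _ fun y => ?_)
    rw [Real.norm_of_nonneg (Real.exp_pos _).le, Real.exp_le_one_iff]
    have : 0 ≤ c * ∑ i, y i ^ 2 := by positivity
    linarith

lemma gaussianPi_mul_tail_le (n : ℕ) (c : ℝ) (hc : 0 ≤ c) :
    gaussianPi (n + 2) {x | c * ∑ i : Fin n, x i.succ.succ ^ 2 ≤ x 0 ^ 2 + x 1 ^ 2} =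
      ENNReal.ofReal ((√(1 + c))⁻¹ ^ n) := by
  have h1 := measurePreserving_piFinSuccAbove (fun _ : Fin (n + 2) => gaussianReal 0 1) 0
  have h2 := measurePreserving_piFinSuccAbove (fun _ : Fin (n + 1) => gaussianReal 0 1) 0
  have h3 := (measurePreserving_prodAssoc (gaussianReal 0 1) (gaussianReal 0 1)
    (Measure.pi fun _ : Fin n => gaussianReal 0 1)).symm
  have h := h3.comp (((MeasurePreserving.id (gaussianReal 0 1)).prod h2).comp h1)
  rw [← gaussianReal_prod_prod_pi_le n c hc,
    ← h.measure_preimage (measurableSet_le (by fun_prop) (by fun_prop)).nullMeasurableSet]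
  rfl

lemma gaussianPi_cone_le (n : ℕ) (c : ℝ) (hc : 0 ≤ c) (u : EuclideanSpace ℝ (Fin (n + 2)))
    (hu : ‖u‖ = 1) :
    gaussianPi (n + 2) {h | c * (sqNorm h - dotp h u.ofLp ^ 2) ≤ dotp h u.ofLp ^ 2} ≤
      ENNReal.ofReal ((√(1 + c))⁻¹ ^ n) := by
  obtain ⟨b, hb⟩ := Orthonormal.exists_orthonormalBasis_extension_of_card_eq
    (𝕜 := ℝ) (E := EuclideanSpace ℝ (Fin (n + 2))) (ι := Fin (n + 2)) (by simp)
    (v := fun _ => u) (s := {0}) ⟨fun _ => hu, fun i j hij => (hij (Subsingleton.elim i j)).elim⟩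
  have hb0 : b 0 = u := hb 0 rfl
  have hmap : (gaussianPi (n + 2)).map (WithLp.toLp 2) =
      (gaussianPi (n + 2)).map (fun x => ∑ i, x i • b i) := by
    rw [gaussianPi, map_pi_eq_stdGaussian, stdGaussian_eq_map_pi_orthonormalBasis b]
  set S : Set (EuclideanSpace ℝ (Fin (n + 2))) :=
    {v | c * (‖v‖ ^ 2 - inner ℝ u v ^ 2) ≤ inner ℝ u v ^ 2}
  have hS : MeasurableSet S := measurableSet_le (by fun_prop) (by fun_prop)
  calc _ = gaussianPi (n + 2) (WithLp.toLp 2 ⁻¹' S) := by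
        congr 1
        ext h
        simp [S, sqNorm, dotp, EuclideanSpace.real_norm_sq_eq, PiLp.inner_apply]
    _ = gaussianPi (n + 2) ((fun x => ∑ i, x i • b i) ⁻¹' S) := by
        rw [← Measure.map_apply (by fun_prop) hS, hmap, Measure.map_apply (by fun_prop) hS]
    _ ≤ gaussianPi (n + 2) {x | c * ∑ i : Fin n, x i.succ.succ ^ 2 ≤ x 0 ^ 2 + x 1 ^ 2} := by
        refine measure_mono fun x hx => ?_
        have hinner : inner ℝ u (∑ i, x i • b i) = x 0 := by
          rw [← hb0, b.orthonormal.inner_right_fintype]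
        have hnorm : ‖∑ i, x i • b i‖ ^ 2 = ∑ i, x i ^ 2 := by
          rw [← b.sum_sq_inner_right]
          exact Finset.sum_congr rfl fun i _ => by rw [b.orthonormal.inner_right_fintype]
        simp only [S, Set.mem_preimage, Set.mem_ofPred_eq, hinner, hnorm] at hx ⊢
        simp only [Fin.sum_univ_succ, Fin.succ_zero_eq_one] at hx
        nlinarith [mul_nonneg hc (sq_nonneg (x 1)), sq_nonneg (x 1)]
    _ = _ := gaussianPi_mul_tail_le n c hc

lemma sqNorm_stdBasis {L : ℕ} (i : Fin L) : sqNorm (stdBasis i) = 1 := by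
  simp [sqNorm, stdBasis]

lemma gaussianPi_fCF_le (n : ℕ) (P : ℝ) (hP : 0 < P) (a : Fin (n + 2) → ℝ) (ha : 1 ≤ sqNorm a) :
    gaussianPi (n + 2) {h | ∀ i, fCF P h a ≤ fCF P h (stdBasis i)} ≤
      ENNReal.ofReal ((√(sqNorm a))⁻¹ ^ n) := by
  have hN : 0 < sqNorm a := by linarith
  set u : EuclideanSpace ℝ (Fin (n + 2)) := WithLp.toLp 2 fun i => (√(sqNorm a))⁻¹ * a i
  have hdot (h : Fin (n + 2) → ℝ) : dotp h a ^ 2 = sqNorm a * dotp h u.ofLp ^ 2 := by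
    have : dotp h u.ofLp = (√(sqNorm a))⁻¹ * dotp h a := by
      simp only [u, dotp, Finset.mul_sum]
      exact Finset.sum_congr rfl fun i _ => by ring
    rw [this, mul_pow, inv_pow, Real.sq_sqrt hN.le]
    field_simp
  have hu : ‖u‖ = 1 := by
    rw [← sq_eq_sq₀ (norm_nonneg u) zero_le_one, EuclideanSpace.real_norm_sq_eq]
    simp only [u, mul_pow, ← Finset.mul_sum, inv_pow, Real.sq_sqrt hN.le]
    rw [one_pow]
    exact inv_mul_cancel₀ hN.ne'
  have hcone := gaussianPi_cone_le n (sqNorm a - 1) (by linarith) u hu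
  rw [add_sub_cancel] at hcone
  refine (measure_mono fun h hh => ?_).trans hcone
  have h0 : fCF P h a ≤ fCF P h (stdBasis 0) := hh 0
  simp only [fCF, sqNorm_stdBasis, hdot] at h0
  have h1 : 0 ≤ P * (sqNorm a * dotp h u.ofLp ^ 2 - (sqNorm a - 1) * sqNorm h) := by
    nlinarith [mul_nonneg hP.le (sq_nonneg (dotp h (stdBasis 0)))]
  have h2 := nonneg_of_mul_nonneg_right h1 hP
  rw [Set.mem_ofPred_eq]
  linarith

/-- For `L ≥ 4` and a fixed integer vector `a` with `‖a‖² ≥ 2`, the probability that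
`f(a) ≤ min_i f(e_i)` is at most `(1/‖a‖²)^(⌊L/2⌋−1) ≤ ‖a‖^{−(L−3)} = e^{−L·E₁(L)}`,
where `E₁(L) = (1 − 3/L)·ln‖a‖ > 0`. -/
theorem statement1 (L : ℕ) (hL : 4 ≤ L) (P : ℝ) (hP : 0 < P)
    (a : Fin L → ℤ) (ha : 2 ≤ sqNorm (fun i => (a i : ℝ))) :
    gaussianPi L {h | ∀ i : Fin L,
        fCF P h (fun j => (a j : ℝ)) ≤ fCF P h (stdBasis i)}
      ≤ ENNReal.ofReal ((1 / sqNorm (fun i => (a i : ℝ))) ^ (L / 2 - 1))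
    ∧ (1 / sqNorm (fun i => (a i : ℝ))) ^ (L / 2 - 1)
        ≤ Real.sqrt (sqNorm (fun i => (a i : ℝ))) ^ (-((L : ℝ) - 3))
    ∧ Real.sqrt (sqNorm (fun i => (a i : ℝ))) ^ (-((L : ℝ) - 3))
        = Real.exp (-(L * ((1 - 3 / (L : ℝ)) *
            Real.log (Real.sqrt (sqNorm (fun i => (a i : ℝ)))))))
    ∧ 0 < (1 - 3 / (L : ℝ)) * Real.log (Real.sqrt (sqNorm (fun i => (a i : ℝ)))) := by
  set N := sqNorm (fun i => (a i : ℝ))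
  have hN : 0 < N := by linarith
  have hs : 1 < √N := Real.lt_sqrt_of_sq_lt (by linarith)
  have hs0 : 0 < √N := by linarith
  have hL' : (4 : ℝ) ≤ L := by exact_mod_cast hL
  have hpow (k : ℕ) : (1 / N) ^ k = (√N)⁻¹ ^ (2 * k) := by
    rw [pow_mul, inv_pow, Real.sq_sqrt hN.le, one_div]
  refine ⟨?_, ?_, ?_, ?_⟩
  · obtain ⟨n, rfl⟩ : ∃ n, L = n + 2 := ⟨L - 2, by omega⟩
    refine (gaussianPi_fCF_le n P hP _ (by linarith)).trans (ENNReal.ofReal_le_ofReal ?_)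
    rw [hpow]
    exact pow_le_pow_of_le_one (inv_nonneg.2 hs0.le) (inv_le_one_of_one_le₀ hs.le) (by omega)
  · rw [hpow, inv_pow, ← Real.rpow_natCast, ← Real.rpow_neg hs0.le]
    refine Real.rpow_le_rpow_of_exponent_le hs.le (neg_le_neg ?_)
    have : L ≤ 2 * (L / 2 - 1) + 3 := by omega
    have : (L : ℝ) ≤ (2 * (L / 2 - 1) : ℕ) + 3 := by exact_mod_cast this
    linarith
  · rw [Real.rpow_def_of_pos hs0]
    congr 1
    field_simp
  · refine mul_pos ?_ (Real.log_pos hs)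
    rw [sub_pos, div_lt_one (by linarith)]
    linarith
end

section
/- Fix P > 0. For each L, let h be a standard Gaussian random vector in ℝ^L. Then the probability that some nonzero integer vector a ∈ ℤ^L which is not a signed standard basis vector (i.e., ‖a‖² ≥ 2) satisfies f(a) ≤ min_{1≤i≤L} f(e_i) tends to 0 as L → ∞. Equivalently, the probability that the minimizer of f over ℤ^L \ {0} is not a signed standard basis vector tends to 0 as L → ∞. -/
open MeasureTheory ProbabilityTheory Filter

open scoped Topology

lemma sum_sub_smul_sq {L : ℕ} (h a : Fin L → ℝ) (t : ℝ) :
    ∑ i, (h i - t * a i) ^ 2 = sqNorm h - 2 * t * dotp h a + t ^ 2 * sqNorm a := by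
  simp only [sqNorm, dotp, Finset.mul_sum, ← Finset.sum_sub_distrib, ← Finset.sum_add_distrib]
  exact Finset.sum_congr rfl fun i _ => by ring

lemma fCF_stdBasis {L : ℕ} (P : ℝ) (h : Fin L → ℝ) (i : Fin L) :
    fCF P h (stdBasis i) = 1 + P * (sqNorm h - h i ^ 2) := by
  have h1 : sqNorm (stdBasis i) = 1 := by simp [sqNorm, stdBasis]
  have h2 : dotp h (stdBasis i) = h i := by simp [dotp, stdBasis]
  rw [fCF, h1, h2, one_mul]

/-- Points in the middle third of `(0, s)` are at distance at least `s / 3` from `t ℤ`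
if `s ≤ |t|`. -/
lemma div_three_le_abs_sub_mul_intCast {s t x : ℝ} (hs : 0 < s) (hst : s ≤ |t|)
    (hx : x ∈ Set.Ioo (s / 3) (2 * s / 3)) (a : ℤ) : s / 3 ≤ |x - t * a| := by
  obtain ⟨hx1, hx2⟩ := hx
  rcases eq_or_ne a 0 with rfl | ha
  · simpa using hx1.le.trans (le_abs_self x)
  · have h1 : (1 : ℝ) ≤ |(a : ℝ)| := by exact_mod_cast Int.one_le_abs ha
    have h2 : s ≤ |t * a| := by
      rw [abs_mul]
      nlinarith
    have h3 : |t * a| - |x| ≤ |x - t * a| := by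
      rw [abs_sub_comm]
      exact abs_sub_abs_le_abs_sub _ _
    rw [abs_of_pos (by linarith : 0 < x)] at h3
    linarith

lemma abs_dotp_intCast_le {L : ℕ} (h : Fin L → ℝ) (a : Fin L → ℤ) {M : ℝ}
    (hM : ∀ i, |h i| ≤ M) : |dotp h (fun i => (a i : ℝ))| ≤ M * sqNorm (fun i => (a i : ℝ)) := by
  unfold dotp sqNorm
  rw [Finset.mul_sum]
  refine (Finset.abs_sum_le_sum_abs _ _).trans (Finset.sum_le_sum fun i _ => ?_)
  rw [abs_mul]
  have h1 : |(a i : ℝ)| ≤ (a i : ℝ) ^ 2 := by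
    rw [← sq_abs]
    rcases eq_or_ne (a i) 0 with h0 | h0
    · simp [h0]
    · have : (1 : ℝ) ≤ |(a i : ℝ)| := by exact_mod_cast Int.one_le_abs h0
      nlinarith
  exact mul_le_mul (hM i) h1 (abs_nonneg _) ((abs_nonneg _).trans (hM i))

set_option maxHeartbeats 800000 in
/-- If the coordinates of `h` often fall in `(c / 3, 2 * c / 3)` and have bounded empirical
fourth moment, then an
integer vector of squared norm at least two which beats all standard basis vectors forces the
dimension to be bounded. -/
lemma card_le_of_fCF_le_stdBasis {P c ρ m : ℝ} (hP : 0 < P) (hc : 0 < c) (hcP : 4 * P * c ^ 2 ≤ 1)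
    (hρ : 0 < ρ) {L : ℕ} (hL : 0 < L) (h : Fin L → ℝ)
    (hspread : ρ * L ≤ ∑ i, (Set.Ioo (c / 3) (2 * c / 3)).indicator (1 : ℝ → ℝ) (h i))
    (hfour : ∑ i, h i ^ 4 ≤ m * L) (a : Fin L → ℤ) (ha : 2 ≤ sqNorm (fun i => (a i : ℝ)))
    (hmin : ∀ i : Fin L, fCF P h (fun j => (a j : ℝ)) ≤ fCF P h (stdBasis i)) :
    (ρ * (c / 3) ^ 2) ^ 4 * L ≤ 4 * m ^ 2 := by
  set n := sqNorm (fun i => (a i : ℝ)) with hn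
  set D := dotp h (fun i => (a i : ℝ)) with hD
  set S := sqNorm h with hS
  set F := ∑ i, h i ^ 4 with hF
  set κ := ρ * (c / 3) ^ 2 with hκ
  have hκ0 : 0 < κ := by positivity
  have hL' : (0 : ℝ) < L := by exact_mod_cast hL
  have hn0 : 0 < n := by linarith
  have hS0 : 0 ≤ S := Finset.sum_nonneg fun i _ => sq_nonneg _
  have key (i : Fin L) : (n - 1) + P * ((n - 1) * S + h i ^ 2) ≤ P * D ^ 2 := by
    have := hmin i
    rw [fCF_stdBasis, fCF] at this
    linarith
  have key' : (n - 1) + P * ((n - 1) * S) ≤ P * D ^ 2 := by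
    nlinarith [key ⟨0, hL⟩, mul_nonneg hP.le (sq_nonneg (h ⟨0, hL⟩))]
  set t := D / n with ht
  have htn : t * n = D := div_mul_cancel₀ _ hn0.ne'
  set Q := ∑ i, (h i - t * a i) ^ 2 with hQ
  have hQ0 : 0 ≤ Q := Finset.sum_nonneg fun i _ => sq_nonneg _
  have hQn : n * Q = n * S - D ^ 2 := by
    rw [hQ, sum_sub_smul_sq h (fun i => (a i : ℝ)) t, ← hn, ← hD, ← hS, ← htn]
    ring
  have hnS : n - 1 ≤ P * S := by
    nlinarith [mul_nonneg hP.le (mul_nonneg hn0.le hQ0)]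
  have hDS : (n - 1) * S ≤ D ^ 2 := by
    have : P * ((n - 1) * S) ≤ P * D ^ 2 := by linarith
    exact le_of_mul_le_mul_left this hP
  have hQS : n * Q ≤ S := by linarith
  have htc : c ≤ |t| := by
    have h1 : n * (n * 1) ≤ n * (n * (4 * P * t ^ 2)) := by
      have e : n * (n * (4 * P * t ^ 2)) = 4 * P * D ^ 2 := by rw [← htn]; ring
      rw [e]
      have h2 : n ≤ 2 * (P * S) := by linarith
      have h3 : n / 2 * (P * S) ≤ (n - 1) * (P * S) :=
        mul_le_mul_of_nonneg_right (by linarith) (by positivity)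
      nlinarith [mul_le_mul_of_nonneg_left hDS hP.le, mul_le_mul_of_nonneg_left h2 hn0.le]
    have h4 : 1 ≤ 4 * P * t ^ 2 := le_of_mul_le_mul_left (le_of_mul_le_mul_left h1 hn0) hn0
    have h5 : c ^ 2 ≤ t ^ 2 := by
      have : (4 * P) * c ^ 2 ≤ (4 * P) * t ^ 2 := by linarith
      exact le_of_mul_le_mul_left this (by positivity)
    simpa [abs_of_pos hc] using sq_le_sq.1 h5
  have hbound (y : Fin L → ℝ) (hy : ∀ i, h i ∈ Set.Ioo (c / 3) (2 * c / 3) → (c / 3) ^ 2 ≤ y i)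
      (hy0 : ∀ i, 0 ≤ y i) : κ * L ≤ ∑ i, y i := by
    calc κ * L = (ρ * L) * (c / 3) ^ 2 := by rw [hκ]; ring
      _ ≤ (∑ i, (Set.Ioo (c / 3) (2 * c / 3)).indicator (1 : ℝ → ℝ) (h i)) * (c / 3) ^ 2 :=
        mul_le_mul_of_nonneg_right hspread (by positivity)
      _ ≤ ∑ i, y i := by
        rw [Finset.sum_mul]
        refine Finset.sum_le_sum fun i _ => ?_
        by_cases hi : h i ∈ Set.Ioo (c / 3) (2 * c / 3)
        · simpa [Set.indicator_of_mem hi] using hy i hi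
        · simpa [Set.indicator_of_notMem hi] using hy0 i
  have hκQ : κ * L ≤ Q := by
    refine hbound _ (fun i hi => ?_) fun i => sq_nonneg _
    rw [← sq_abs (h i - t * a i)]
    have := div_three_le_abs_sub_mul_intCast hc htc hi (a i)
    exact pow_le_pow_left₀ (by positivity) this 2
  have hκS : κ * L ≤ S := by
    refine hbound _ (fun i hi => ?_) fun i => sq_nonneg _
    exact pow_le_pow_left₀ (by positivity) hi.1.le 2
  have hSF : S ^ 2 ≤ L * F := by
    have := sq_sum_le_card_mul_sum_sq (s := Finset.univ) (f := fun i => h i ^ 2)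
    simpa [← pow_mul, hS, hF, sqNorm] using this
  have hS2 : S ^ 2 ≤ m * L ^ 2 := by nlinarith
  have hnκ : (n * κ) ^ 2 ≤ m := by
    have h1 : n * κ * L ≤ S := by nlinarith
    have h2 : (n * κ * L) ^ 2 ≤ S ^ 2 := pow_le_pow_left₀ (by positivity) h1 2
    refine le_of_mul_le_mul_right (a := (L : ℝ) ^ 2) ?_ (by positivity)
    nlinarith
  obtain ⟨j, -, hj⟩ := Finset.exists_max_image Finset.univ (fun i => |h i|)
    ⟨⟨0, hL⟩, Finset.mem_univ _⟩
  set M := |h j| with hM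
  have hDM : |D| ≤ M * n := abs_dotp_intCast_le h a fun i => hj i (Finset.mem_univ i)
  have hSM : S ≤ 2 * n * M ^ 2 := by
    have h1 : D ^ 2 ≤ (M * n) ^ 2 := by
      rw [← sq_abs]
      exact pow_le_pow_left₀ (abs_nonneg _) hDM 2
    have h2 : n * S ≤ n * (2 * n * M ^ 2) := by nlinarith
    exact le_of_mul_le_mul_left h2 hn0
  have hMF : M ^ 4 ≤ F := by
    have : h j ^ 4 ≤ F := Finset.single_le_sum (f := fun i => h i ^ 4)
      (fun i _ => by positivity) (Finset.mem_univ j)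
    calc M ^ 4 = (M ^ 2) ^ 2 := by ring
      _ = h j ^ 4 := by rw [hM, sq_abs]; ring
      _ ≤ F := this
  have h1 : (κ * L) ^ 2 ≤ 4 * n ^ 2 * (m * L) := by
    calc (κ * L) ^ 2 ≤ (2 * n * M ^ 2) ^ 2 :=
          pow_le_pow_left₀ (by positivity) (hκS.trans hSM) 2
      _ = 4 * n ^ 2 * M ^ 4 := by ring
      _ ≤ 4 * n ^ 2 * (m * L) := mul_le_mul_of_nonneg_left (hMF.trans hfour) (by positivity)
  have hm : 0 ≤ m := (sq_nonneg _).trans hnκ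
  have h2 : κ ^ 2 * L ≤ 4 * n ^ 2 * m := by
    refine le_of_mul_le_mul_right (a := (L : ℝ)) ?_ hL'
    linarith
  calc κ ^ 4 * L = κ ^ 2 * (κ ^ 2 * L) := by ring
    _ ≤ κ ^ 2 * (4 * n ^ 2 * m) := mul_le_mul_of_nonneg_left h2 (by positivity)
    _ = 4 * m * (n * κ) ^ 2 := by ring
    _ ≤ 4 * m * m := mul_le_mul_of_nonneg_left hnκ (by positivity)
    _ = 4 * m ^ 2 := by ring

/-- Weak law of large numbers for the coordinates of a product measure. -/
lemma tendsto_measure_pi_sum_deviation {Ω : Type*} [MeasurableSpace Ω] (μ : Measure Ω)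
    [IsProbabilityMeasure μ] {X : Ω → ℝ} (hX : MemLp X 2 μ) {ε : ℝ} (hε : 0 < ε) :
    Tendsto (fun L : ℕ => Measure.pi (fun _ : Fin L => μ)
      {h | ε * L ≤ |∑ i, X (h i) - L * μ[X]|}) atTop (𝓝 0) := by
  have hlim : Tendsto (fun L : ℕ => ENNReal.ofReal (Var[X; μ] / ε ^ 2 * (L : ℝ)⁻¹))
      atTop (𝓝 0) := by
    have := (tendsto_inv_atTop_nhds_zero_nat (𝕜 := ℝ)).const_mul (Var[X; μ] / ε ^ 2)
    rw [mul_zero] at this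
    simpa using ENNReal.tendsto_ofReal this
  refine tendsto_of_tendsto_of_tendsto_of_le_of_le' tendsto_const_nhds hlim
    (Eventually.of_forall fun _ => zero_le) ?_
  filter_upwards [eventually_gt_atTop 0] with L hL
  have hL' : (0 : ℝ) < L := by exact_mod_cast hL
  have hcomp (i : Fin L) : MemLp (fun h : Fin L → Ω => X (h i)) 2 (Measure.pi fun _ => μ) :=
    hX.comp_measurePreserving (measurePreserving_eval (fun _ : Fin L => μ) i)
  have hmean : ∫ h, (∑ i, fun h : Fin L → Ω => X (h i)) h ∂(Measure.pi fun _ : Fin L => μ)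
      = L * μ[X] := by
    simp only [Finset.sum_apply]
    rw [integral_finsetSum _ fun i _ => (hcomp i).integrable one_le_two]
    have hev (i : Fin L) : ∫ h : Fin L → Ω, X (h i) ∂(Measure.pi fun _ => μ) = μ[X] :=
      integral_comp_eval (μ := fun _ : Fin L => μ) (i := i) hX.aestronglyMeasurable
    simp [hev]
  have hvar : Var[∑ i, fun h : Fin L → Ω => X (h i); Measure.pi fun _ => μ] = L * Var[X; μ] := by
    rw [variance_sum_pi fun _ => hX]
    simp
  have := meas_ge_le_variance_div_sq (memLp_finsetSum' Finset.univ fun i _ => hcomp i)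
    (mul_pos hε hL')
  rw [hmean, hvar] at this
  simp only [Finset.sum_apply] at this
  refine this.trans (ENNReal.ofReal_le_ofReal (le_of_eq ?_))
  field_simp

lemma memLp_pow_four_gaussianReal : MemLp (fun x : ℝ => x ^ 4) 2 (gaussianReal 0 1) := by
  rw [memLp_two_iff_integrable_sq (by fun_prop)]
  have := (memLp_id_gaussianReal (μ := 0) (v := 1) 8).integrable_norm_pow (by norm_num)
  refine this.congr (Eventually.of_forall fun x => ?_)
  simp only [id, Real.norm_eq_abs, ← pow_mul]
  exact Even.pow_abs (by decide) x

lemma gaussianReal_real_Ioo_pos {a b : ℝ} (hab : a < b) :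
    0 < (gaussianReal 0 1).real (Set.Ioo a b) := by
  have := (gaussianReal_absolutelyContinuous' 0 (v := 1) one_ne_zero).isOpenPosMeasure
  exact ENNReal.toReal_pos (isOpen_Ioo.measure_pos _ (Set.nonempty_Ioo.2 hab)).ne'
    (measure_ne_top _ _)

/-- As `L → ∞`, the probability that some nonzero integer vector `a` which is not a signed
standard basis vector (i.e. `‖a‖² ≥ 2`) satisfies `f(a) ≤ min_i f(e_i)` tends to `0`;
equivalently, with probability tending to one the minimizer of `f` over `ℤ^L \ {0}` is a
signed standard basis vector. -/
theorem statement2 (P : ℝ) (hP : 0 < P) :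
    Tendsto (fun L : ℕ =>
        gaussianPi L {h | ∃ a : Fin L → ℤ, a ≠ 0 ∧
          2 ≤ sqNorm (fun i => (a i : ℝ)) ∧
          ∀ i : Fin L, fCF P h (fun j => (a j : ℝ)) ≤ fCF P h (stdBasis i)})
      atTop (nhds 0) := by
  obtain ⟨c, hc, hcP⟩ : ∃ c : ℝ, 0 < c ∧ 4 * P * c ^ 2 ≤ 1 := by
    refine ⟨1 / (2 * √P), by positivity, le_of_eq ?_⟩
    rw [div_pow, mul_pow, Real.sq_sqrt hP.le]
    field_simp
    norm_num
  set I := Set.Ioo (c / 3) (2 * c / 3)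
  set p := (gaussianReal 0 1).real I
  have hp : 0 < p := gaussianReal_real_Ioo_pos (by linarith)
  set q := ∫ x, x ^ 4 ∂(gaussianReal 0 1)
  have hI : MemLp (I.indicator (1 : ℝ → ℝ)) 2 (gaussianReal 0 1) :=
    (memLp_const (1 : ℝ)).indicator measurableSet_Ioo
  have hlim := (tendsto_measure_pi_sum_deviation _ hI (half_pos hp)).add
    (tendsto_measure_pi_sum_deviation _ memLp_pow_four_gaussianReal one_pos)
  rw [add_zero] at hlim
  refine tendsto_of_tendsto_of_tendsto_of_le_of_le' tendsto_const_nhds hlim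
    (Eventually.of_forall fun _ => zero_le) ?_
  have hκ : 0 < (p / 2 * (c / 3) ^ 2) ^ 4 := by positivity
  have hlarge : ∀ᶠ L : ℕ in atTop, 4 * (q + 1) ^ 2 < (p / 2 * (c / 3) ^ 2) ^ 4 * L :=
    (tendsto_natCast_atTop_atTop.const_mul_atTop hκ).eventually_gt_atTop _
  filter_upwards [hlarge, eventually_gt_atTop 0] with L hL hL0
  refine (measure_mono ?_).trans (measure_union_le _ _)
  rintro h ⟨a, -, ha, hmin⟩
  by_contra hgood
  simp only [Set.mem_union, Set.mem_ofPred_eq, not_or, not_le, abs_lt] at hgood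
  rw [integral_indicator_one measurableSet_Ioo] at hgood
  obtain ⟨⟨h1, -⟩, -, h2⟩ := hgood
  exact hL.not_ge <| card_le_of_fCF_le_stdBasis hP hc hcP (half_pos hp) hL0 h
    (by linarith) (by linarith) a ha hmin
end

section
/- Fix P > 0. For each L, let h be a standard Gaussian random vector in ℝ^L. Then the best achievable CF computation rate over all integer coefficient vectors converges to zero in probability as the number of users grows: for every ε > 0, lim_{L→∞} P( ∃ a ∈ ℤ^L, a ≠ 0, with R(h,a) > ε ) = 0. -/
open MeasureTheory ProbabilityTheory Filter

/-- `log⁺(x) = max(log₂ x, 0)`. -/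
noncomputable def logPlus (x : ℝ) : ℝ := max (Real.logb 2 x) 0

/-- The Compute-and-Forward computation rate
`R(h,a) = (1/2)·log⁺((‖a‖² − P⟨h,a⟩²/(1+P‖h‖²))⁻¹)`. -/
noncomputable def Rcf {L : ℕ} (P : ℝ) (h a : Fin L → ℝ) : ℝ :=
  (1 / 2) * logPlus ((sqNorm a - P * (dotp h a) ^ 2 / (1 + P * sqNorm h))⁻¹)

theorem sqNorm_sub_mul_dotp_eq {L : ℕ} {P : ℝ} (hP : 0 < P) (h a : Fin L → ℝ) :
    sqNorm a - P * dotp h a ^ 2 / (1 + P * sqNorm h) =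
      (∑ i, (a i - P * dotp h a / (1 + P * sqNorm h) * h i) ^ 2) +
        (P * dotp h a / (1 + P * sqNorm h)) ^ 2 / P := by
  have hpos : 0 < 1 + P * sqNorm h := by
    have : 0 ≤ sqNorm h := Finset.sum_nonneg fun i _ => sq_nonneg _
    positivity
  set t := P * dotp h a / (1 + P * sqNorm h) with ht
  have hsum : ∑ i, (a i - t * h i) ^ 2 = sqNorm a - 2 * t * dotp h a + t ^ 2 * sqNorm h := by
    simp only [sqNorm, dotp, Finset.mul_sum, ← Finset.sum_sub_distrib, ← Finset.sum_add_distrib]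
    exact Finset.sum_congr rfl fun i _ => by ring
  rw [hsum, ht]
  field_simp
  ring

theorem lt_sq_rpow_neg_of_lt_Rcf {L : ℕ} {P ε : ℝ} (hP : 0 < P) (hε : 0 < ε) {h a : Fin L → ℝ}
    (hR : ε < Rcf P h a) :
    sqNorm a - P * dotp h a ^ 2 / (1 + P * sqNorm h) < ((2 : ℝ) ^ (-ε)) ^ 2 := by
  have hs : 0 < (2 : ℝ) ^ (-ε) := by positivity
  have hnonneg : 0 ≤ sqNorm a - P * dotp h a ^ 2 / (1 + P * sqNorm h) := by
    rw [sqNorm_sub_mul_dotp_eq hP]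
    exact add_nonneg (Finset.sum_nonneg fun i _ => sq_nonneg _) (by positivity)
  rw [Rcf, logPlus] at hR
  generalize sqNorm a - P * dotp h a ^ 2 / (1 + P * sqNorm h) = f at *
  rcases hnonneg.eq_or_lt with rfl | hf
  · positivity
  have hlog : 2 * ε < Real.logb 2 f⁻¹ := by
    rcases lt_max_iff.mp (show 2 * ε < max (Real.logb 2 f⁻¹) 0 by linarith) with h1 | h1
    · exact h1
    · linarith
  rw [Real.lt_logb_iff_rpow_lt (by norm_num) (by positivity)] at hlog
  have heq : ((2 : ℝ) ^ (-ε)) ^ 2 = ((2 : ℝ) ^ (2 * ε))⁻¹ := by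
    rw [← Real.rpow_natCast, ← Real.rpow_mul (by norm_num), ← Real.rpow_neg (by norm_num)]
    congr 1
    push_cast
    ring
  rw [heq]
  exact (lt_inv_comm₀ (by positivity) hf).mp hlog

theorem sq_le_sq_intCast_sub {x : ℝ} (hx : |x| ≤ 1 / 2) (n : ℤ) : x ^ 2 ≤ ((n : ℝ) - x) ^ 2 := by
  rcases eq_or_ne n 0 with rfl | hn
  · simp
  have h1 : (1 : ℝ) ≤ |(n : ℝ)| := by exact_mod_cast Int.one_le_abs hn
  rw [sq_le_sq]
  linarith [abs_sub_abs_le_abs_sub (n : ℝ) x]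

/-- The square function truncated to vanish outside `[-r, r]`. -/
noncomputable def truncSq (r : ℝ) : ℝ → ℝ := (Set.Icc (-r) r).indicator fun x => x ^ 2

theorem truncSq_mem_Icc (r x : ℝ) : truncSq r x ∈ Set.Icc 0 (r ^ 2) := by
  unfold truncSq
  by_cases hx : x ∈ Set.Icc (-r) r
  · rw [Set.indicator_of_mem hx]
    exact ⟨sq_nonneg x, sq_le_sq' hx.1 hx.2⟩
  · rw [Set.indicator_of_notMem hx]
    exact ⟨le_rfl, sq_nonneg r⟩

theorem measurable_truncSq (r : ℝ) : Measurable (truncSq r) :=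
  (by fun_prop : Measurable fun x : ℝ => x ^ 2).indicator measurableSet_Icc

theorem memLp_truncSq (r : ℝ) (p : ENNReal) : MemLp (truncSq r) p (gaussianReal 0 1) := by
  refine MemLp.of_bound (measurable_truncSq r).aestronglyMeasurable (r ^ 2) (.of_forall fun x => ?_)
  rw [Real.norm_of_nonneg (truncSq_mem_Icc r x).1]
  exact (truncSq_mem_Icc r x).2

theorem integral_truncSq_pos {r : ℝ} (hr : 0 < r) : 0 < ∫ x, truncSq r x ∂gaussianReal 0 1 := by
  rw [integral_pos_iff_support_of_nonneg (fun x => (truncSq_mem_Icc r x).1)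
    (memLp_one_iff_integrable.mp (memLp_truncSq r 1)), pos_iff_ne_zero]
  intro h0
  have h1 := gaussianReal_absolutelyContinuous' 0 one_ne_zero h0
  have hsub : Set.Ioo 0 r ⊆ Function.support (truncSq r) := by
    intro x hx
    have hx' : x ∈ Set.Icc (-r) r := ⟨by linarith [hx.1], hx.2.le⟩
    rw [Function.mem_support, truncSq, Set.indicator_of_mem hx']
    exact pow_ne_zero 2 hx.1.ne'
  have h2 := measure_mono_null hsub h1
  rw [Real.volume_Ioo, ENNReal.ofReal_eq_zero] at h2
  linarith

/-- If an integer vector achieves MMSE value below `s ^ 2 < 1`, then the channel vector has either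
little mass near the origin or a large fourth moment. -/
theorem sum_truncSq_le_or_le_sum_pow_four {L : ℕ} {P s κ : ℝ} (hP : 0 < P) (hs : 0 < s)
    (hs1 : s < 1) (hκ : 0 < κ) {h : Fin L → ℝ} {a : Fin L → ℤ} (ha : a ≠ 0)
    (hlt : sqNorm (fun i => (a i : ℝ)) - P * dotp h (fun i => (a i : ℝ)) ^ 2 /
      (1 + P * sqNorm h) < s ^ 2) :
    ∑ i, truncSq (1 / (2 * √P)) (h i) ≤ κ * L ∨
      κ ^ 2 * (1 - s) ^ 4 * (L : ℝ) ^ 2 ≤ ∑ i, h i ^ 4 := by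
  by_contra! hcon
  obtain ⟨hκlt, h4⟩ := hcon
  rw [sqNorm_sub_mul_dotp_eq hP] at hlt
  generalize P * dotp h (fun i => (a i : ℝ)) / (1 + P * sqNorm h) = t at hlt
  have hsP : 0 < √P := Real.sqrt_pos.mpr hP
  have hres : ∑ i, ((a i : ℝ) - t * h i) ^ 2 < s ^ 2 := by
    have : 0 ≤ t ^ 2 / P := by positivity
    linarith
  have ht : |t| ≤ √P := by
    apply Real.abs_le_sqrt
    have h0 : 0 ≤ ∑ i, ((a i : ℝ) - t * h i) ^ 2 := Finset.sum_nonneg fun i _ => sq_nonneg _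
    have h1 : t ^ 2 / P < 1 := by nlinarith
    exact ((div_lt_one hP).mp h1).le
  have hg : t ^ 2 * ∑ i, truncSq (1 / (2 * √P)) (h i) ≤ ∑ i, ((a i : ℝ) - t * h i) ^ 2 := by
    rw [Finset.mul_sum]
    refine Finset.sum_le_sum fun i _ => ?_
    unfold truncSq
    by_cases hi : h i ∈ Set.Icc (-(1 / (2 * √P))) (1 / (2 * √P))
    · rw [Set.indicator_of_mem hi, ← mul_pow]
      refine sq_le_sq_intCast_sub ?_ _
      calc |t * h i| = |t| * |h i| := abs_mul _ _
        _ ≤ √P * (1 / (2 * √P)) := by gcongr; exact abs_le.mpr hi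
        _ = 1 / 2 := by field_simp
    · rw [Set.indicator_of_notMem hi, mul_zero]
      exact sq_nonneg _
  have htL : t ^ 2 * (κ * L) ≤ 1 := by
    have := mul_le_mul_of_nonneg_left hκlt.le (sq_nonneg t)
    nlinarith
  obtain ⟨i, hi⟩ := Function.ne_iff.mp ha
  have hi1 : (1 : ℝ) ≤ |(a i : ℝ)| := by exact_mod_cast Int.one_le_abs hi
  have hh4 : h i ^ 4 ≤ κ ^ 2 * (1 - s) ^ 4 * (L : ℝ) ^ 2 :=
    (Finset.single_le_sum (f := fun i => h i ^ 4) (fun j _ => by positivity)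
      (Finset.mem_univ i)).trans h4.le
  have hth : |t * h i| ≤ 1 - s := by
    rw [← abs_of_pos (sub_pos.mpr hs1), ← pow_le_pow_iff_left₀ (abs_nonneg _) (abs_nonneg _)
      four_ne_zero, Even.pow_abs (by decide), Even.pow_abs (by decide)]
    calc (t * h i) ^ 4 = t ^ 4 * h i ^ 4 := by ring
      _ ≤ t ^ 4 * (κ ^ 2 * (1 - s) ^ 4 * (L : ℝ) ^ 2) := by gcongr
      _ = (t ^ 2 * (κ * L)) ^ 2 * (1 - s) ^ 4 := by ring
      _ ≤ 1 ^ 2 * (1 - s) ^ 4 := by gcongr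
      _ = (1 - s) ^ 4 := by ring
  have hri : ((a i : ℝ) - t * h i) ^ 2 < s ^ 2 :=
    (Finset.single_le_sum (f := fun i => ((a i : ℝ) - t * h i) ^ 2) (fun j _ => sq_nonneg _)
      (Finset.mem_univ i)).trans_lt hres
  have := abs_lt_of_sq_lt_sq hri hs.le
  linarith [abs_sub_abs_le_abs_sub (a i : ℝ) (t * h i)]

instance isProbabilityMeasure_gaussianPi (L : ℕ) : IsProbabilityMeasure (gaussianPi L) := by
  unfold gaussianPi
  infer_instance

theorem memLp_comp_eval_gaussianPi {L : ℕ} {p : ENNReal} {g : ℝ → ℝ}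
    (hg : MemLp g p (gaussianReal 0 1)) (i : Fin L) :
    MemLp (fun h : Fin L → ℝ => g (h i)) p (gaussianPi L) :=
  hg.comp_measurePreserving (measurePreserving_eval (fun _ : Fin L => gaussianReal 0 1) i)

theorem integral_sum_gaussianPi {L : ℕ} {g : ℝ → ℝ} (hg : MemLp g 1 (gaussianReal 0 1)) :
    ∫ h, ∑ i, g (h i) ∂gaussianPi L = L * ∫ x, g x ∂gaussianReal 0 1 := by
  rw [integral_finsetSum _ fun i _ =>
    memLp_one_iff_integrable.mp (memLp_comp_eval_gaussianPi hg i)]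
  have : ∀ i : Fin L, ∫ h, g (h i) ∂gaussianPi L = ∫ x, g x ∂gaussianReal 0 1 := fun i =>
    integral_comp_eval (μ := fun _ : Fin L => gaussianReal 0 1) hg.aestronglyMeasurable
  simp [this]

/-- Chebyshev bound for the lower tail of an i.i.d. sum. -/
theorem gaussianPi_sum_le_half_mean_le {g : ℝ → ℝ} (hg : MemLp g 2 (gaussianReal 0 1))
    (hpos : 0 < ∫ x, g x ∂gaussianReal 0 1) {L : ℕ} (hL : 0 < L) :
    gaussianPi L {h | ∑ i, g (h i) ≤ (∫ x, g x ∂gaussianReal 0 1) / 2 * L} ≤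
      ENNReal.ofReal
        (Var[g; gaussianReal 0 1] / ((∫ x, g x ∂gaussianReal 0 1) / 2) ^ 2 / L) := by
  have hL' : (0 : ℝ) < L := by exact_mod_cast hL
  have hmean := integral_sum_gaussianPi (L := L) (hg.mono_exponent one_le_two)
  set m := ∫ x, g x ∂gaussianReal 0 1
  have hvar : Var[fun h : Fin L → ℝ => ∑ i, g (h i); gaussianPi L] =
      L * Var[g; gaussianReal 0 1] := by
    have := variance_sum_pi (μ := fun _ : Fin L => gaussianReal 0 1) (X := fun _ => g)
      fun _ => hg
    simp only [Finset.sum_const, Finset.card_univ, Fintype.card_fin, nsmul_eq_mul] at this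
    rw [← this, gaussianPi]
    congr 1
    ext h
    simp
  have hmem : MemLp (fun h : Fin L → ℝ => ∑ i, g (h i)) 2 (gaussianPi L) :=
    memLp_finsetSum _ fun i _ => memLp_comp_eval_gaussianPi hg i
  have hcheb := meas_ge_le_variance_div_sq hmem (c := m / 2 * L) (by positivity)
  rw [hmean, hvar] at hcheb
  refine (measure_mono fun h hh => ?_).trans (hcheb.trans_eq ?_)
  · simp only [Set.mem_ofPred_eq] at hh ⊢
    rw [abs_sub_comm]
    exact le_trans (by linarith) (le_abs_self _)
  · congr 1
    field_simp

/-- Markov bound for the sum of fourth powers of the coordinates. -/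
theorem gaussianPi_le_sum_pow_four_le {c : ℝ} (hc : 0 < c) {L : ℕ} (hL : 0 < L) :
    gaussianPi L {h | c * (L : ℝ) ^ 2 ≤ ∑ i, h i ^ 4} ≤
      ENNReal.ofReal ((∫ x, x ^ 4 ∂gaussianReal 0 1) / c / L) := by
  have hL' : (0 : ℝ) < L := by exact_mod_cast hL
  have hg : MemLp (fun x : ℝ => x ^ 4) 1 (gaussianReal 0 1) := by
    rw [memLp_one_iff_integrable]
    have := (memLp_id_gaussianReal (μ := 0) (v := 1) 4).integrable_norm_pow (by norm_num)
    refine (integrable_congr (.of_forall fun x => ?_)).mp this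
    simp [Even.pow_abs (by decide : Even 4)]
  have hint : Integrable (fun h : Fin L → ℝ => ∑ i, h i ^ 4) (gaussianPi L) :=
    integrable_finsetSum _ fun i _ =>
      memLp_one_iff_integrable.mp (memLp_comp_eval_gaussianPi hg i)
  have hmarkov := mul_meas_ge_le_integral_of_nonneg
    (.of_forall fun h => Finset.sum_nonneg fun i _ => by positivity) hint (c * (L : ℝ) ^ 2)
  rw [integral_sum_gaussianPi hg] at hmarkov
  rw [← ofReal_measureReal]
  apply ENNReal.ofReal_le_ofReal
  rw [div_div, le_div_iff₀ (by positivity)]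
  refine le_of_mul_le_mul_left ?_ hL'
  linarith

/-- The best achievable CF computation rate over all nonzero integer coefficient vectors
converges to zero in probability as the number of users `L` grows. -/
theorem statement3 (P : ℝ) (hP : 0 < P) :
    ∀ ε > (0 : ℝ),
      Tendsto (fun L : ℕ =>
          gaussianPi L {h | ∃ a : Fin L → ℤ, a ≠ 0 ∧
            ε < Rcf P h fun i => (a i : ℝ)})
        atTop (nhds 0) := by
  intro ε hε
  set s : ℝ := (2 : ℝ) ^ (-ε)
  have hs : 0 < s := by positivity
  have hs1 : s < 1 := Real.rpow_lt_one_of_one_lt_of_neg (by norm_num) (by linarith)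
  have hr : 0 < 1 / (2 * √P) := by positivity
  have hm := integral_truncSq_pos hr
  set m := ∫ x, truncSq (1 / (2 * √P)) x ∂gaussianReal 0 1
  have hc : 0 < (m / 2) ^ 2 * (1 - s) ^ 4 := by
    have : 0 < 1 - s := by linarith
    positivity
  have hlim (C : ℝ) : Tendsto (fun L : ℕ => ENNReal.ofReal (C / L)) atTop (nhds 0) := by
    simpa using ENNReal.tendsto_ofReal (tendsto_const_div_atTop_nhds_zero_nat C)
  have hsum := (hlim (Var[truncSq (1 / (2 * √P)); gaussianReal 0 1] / (m / 2) ^ 2)).add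
    (hlim ((∫ x, x ^ 4 ∂gaussianReal 0 1) / ((m / 2) ^ 2 * (1 - s) ^ 4)))
  rw [add_zero] at hsum
  refine tendsto_of_tendsto_of_tendsto_of_le_of_le' tendsto_const_nhds hsum
    (.of_forall fun _ => zero_le) ?_
  filter_upwards [eventually_gt_atTop 0] with L hL
  refine (measure_mono ?_).trans ((measure_union_le _ _).trans (add_le_add
    (gaussianPi_sum_le_half_mean_le (memLp_truncSq (1 / (2 * √P)) 2) hm hL)
    (gaussianPi_le_sum_pow_four_le hc hL)))
  rintro h ⟨a, ha, hR⟩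
  exact sum_truncSq_le_or_le_sum_pow_four hP hs hs1 (by positivity) ha
    (lt_sq_rpow_neg_of_lt_Rcf hP hε hR)
end

section
/- Let L ≥ 4 and let a ∈ ℝ^L be a fixed nonzero vector. Let h be a standard Gaussian random vector in ℝ^L. Then for every α ∈ [0,1], P( ⟨a,h⟩²/(‖a‖²‖h‖²) ≤ α ) ≥ 1 − (1−α)^{⌊L/2⌋ − 1}; equivalently, P( ⟨a,h⟩²/(‖a‖²‖h‖²) ≥ α ) ≤ (1−α)^{⌊L/2⌋ − 1}. That is, the CDF of the squared cosine of the angle between a and h is bounded below by the CDF of the minimum of ⌊L/2⌋ − 1 i.i.d. uniform random variables on [0,1]. -/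
open MeasureTheory ProbabilityTheory Filter

/-- Translating a set away from the origin by `s` costs a factor `exp (-s² / 2)` in Gaussian
measure. -/
lemma gaussianReal_preimage_sub_le {A : Set ℝ} (hA : MeasurableSet A) {s : ℝ}
    (h : ∀ x ∈ A, 0 ≤ s * x) :
    gaussianReal 0 1 ((fun x => x - s) ⁻¹' A)
      ≤ ENNReal.ofReal (Real.exp (-s ^ 2 / 2)) * gaussianReal 0 1 A := by
  rw [gaussianReal_apply _ one_ne_zero, gaussianReal_apply _ one_ne_zero,
    ← lintegral_indicator (hA.preimage (by fun_prop)), ← lintegral_indicator hA,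
    ← lintegral_const_mul _ ((measurable_gaussianPDF 0 1).indicator hA),
    ← lintegral_add_right_eq_self _ s]
  refine lintegral_mono fun x => ?_
  by_cases hx : x ∈ A
  · rw [Set.indicator_of_mem (by simpa using hx), Set.indicator_of_mem hx, gaussianPDF,
      gaussianPDF, ← ENNReal.ofReal_mul (Real.exp_nonneg _)]
    refine ENNReal.ofReal_le_ofReal ?_
    rw [gaussianPDFReal, gaussianPDFReal, mul_left_comm, ← Real.exp_add]
    gcongr
    have := h x hx
    simp only [NNReal.coe_one]
    linarith
  · rw [Set.indicator_of_notMem (by simpa using hx)]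
    exact zero_le

/-- The two-sided Gaussian tail bound, in terms of the square. -/
lemma gaussianReal_sq_ge_le (t : ℝ) :
    gaussianReal 0 1 {x | t ≤ x ^ 2} ≤ ENNReal.ofReal (Real.exp (-t / 2)) := by
  rcases lt_or_ge t 0 with ht | ht
  · refine prob_le_one.trans ?_
    rw [ENNReal.one_le_ofReal]
    exact Real.one_le_exp (by linarith)
  have := nullSingletonClass_gaussianReal (μ := 0) (v := 1) one_ne_zero
  set s := √t
  have hs : s ^ 2 = t := Real.sq_sqrt ht
  have hs0 : 0 ≤ s := Real.sqrt_nonneg t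
  have hsub : {x : ℝ | t ≤ x ^ 2} ⊆
      ((fun x => x - s) ⁻¹' Set.Ici 0) ∪ ((fun x => x - -s) ⁻¹' Set.Iic 0) := by
    intro x hx
    rw [Set.mem_ofPred_eq, ← hs, sq_le_sq, abs_of_nonneg hs0, le_abs] at hx
    rcases hx with hx | hx
    · left; simpa using hx
    · right; simp only [Set.mem_preimage, Set.mem_Iic]; linarith
  have hsum : gaussianReal 0 1 (Set.Ici 0) + gaussianReal 0 1 (Set.Iic 0) = 1 := by
    rw [measure_congr (Iio_ae_eq_Iic (μ := gaussianReal 0 1) (a := (0 : ℝ))).symm,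
      ← Set.compl_Ici, prob_add_prob_compl measurableSet_Ici]
  calc gaussianReal 0 1 {x | t ≤ x ^ 2}
      ≤ _ := (measure_mono hsub).trans (measure_union_le _ _)
    _ ≤ ENNReal.ofReal (Real.exp (-s ^ 2 / 2)) * gaussianReal 0 1 (Set.Ici 0)
        + ENNReal.ofReal (Real.exp (-(-s) ^ 2 / 2)) * gaussianReal 0 1 (Set.Iic 0) := by
      gcongr
      · exact gaussianReal_preimage_sub_le measurableSet_Ici fun x hx => mul_nonneg hs0 hx
      · exact gaussianReal_preimage_sub_le measurableSet_Iic fun x hx =>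
          mul_nonneg_of_nonpos_of_nonpos (by linarith) hx
    _ = ENNReal.ofReal (Real.exp (-t / 2)) := by
      rw [neg_sq, hs, ← mul_add, hsum, mul_one]

/-- The Laplace transform of the square of a standard Gaussian variable. -/
lemma lintegral_exp_neg_mul_sq_gaussianReal {c : ℝ} (hc : 0 ≤ c) :
    ∫⁻ x, ENNReal.ofReal (Real.exp (-(c * x ^ 2) / 2)) ∂gaussianReal 0 1
      = ENNReal.ofReal (√(1 + c)⁻¹) := by
  have hc1 : 0 < 1 + c := by linarith
  let v : NNReal := ⟨(1 + c)⁻¹, by positivity⟩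
  have hv : v ≠ 0 := by
    rw [← NNReal.coe_ne_zero]
    exact (inv_pos.2 hc1).ne'
  rw [gaussianReal_of_var_ne_zero _ one_ne_zero,
    lintegral_withDensity_eq_lintegral_mul _ (measurable_gaussianPDF 0 1) (by fun_prop)]
  calc _ = ∫⁻ x, ENNReal.ofReal (√(1 + c)⁻¹) * gaussianPDF 0 v x := by
        refine lintegral_congr fun x => ?_
        rw [Pi.mul_apply, gaussianPDF, gaussianPDF,
          ← ENNReal.ofReal_mul (gaussianPDFReal_nonneg _ _ _),
          ← ENNReal.ofReal_mul (Real.sqrt_nonneg _)]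
        congr 1
        rw [gaussianPDFReal, gaussianPDFReal, mul_assoc, ← Real.exp_add, ← mul_assoc]
        change _ = √(1 + c)⁻¹ * (√(2 * Real.pi * (1 + c)⁻¹))⁻¹
          * Real.exp (-(x - 0) ^ 2 / (2 * (1 + c)⁻¹))
        rw [Real.sqrt_mul (by positivity) (1 + c)⁻¹]
        have h0 : √(1 + c)⁻¹ ≠ 0 := (Real.sqrt_pos.2 (inv_pos.2 hc1)).ne'
        congr 1
        · simp only [NNReal.coe_one, mul_one]
          field_simp
        · congr 1
          simp only [NNReal.coe_one]
          field_simp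
          ring
    _ = _ := by
        rw [lintegral_const_mul _ (measurable_gaussianPDF 0 v), lintegral_gaussianPDF_eq_one _ hv,
          mul_one]

lemma lintegral_exp_neg_mul_sum_sq_gaussian {n : ℕ} {c : ℝ} (hc : 0 ≤ c) :
    ∫⁻ y : Fin n → ℝ, ENNReal.ofReal (Real.exp (-(c * ∑ i, y i ^ 2) / 2))
        ∂Measure.pi (fun _ => gaussianReal 0 1)
      = ENNReal.ofReal (√(1 + c)⁻¹) ^ n := by
  have hX : Measurable fun x : ℝ => ENNReal.ofReal (Real.exp (-(c * x ^ 2) / 2)) := by fun_prop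
  have hprod : ∀ y : Fin n → ℝ, ENNReal.ofReal (Real.exp (-(c * ∑ i, y i ^ 2) / 2))
      = ∏ i, ENNReal.ofReal (Real.exp (-(c * y i ^ 2) / 2)) := fun y => by
    rw [← ENNReal.ofReal_prod_of_nonneg fun i _ => Real.exp_nonneg _, ← Real.exp_sum,
      Finset.mul_sum, ← Finset.sum_neg_distrib, Finset.sum_div]
  simp_rw [hprod]
  rw [lintegral_prod_eq_prod_lintegral_of_indepFun _ _
    (iIndepFun_pi (μ := fun _ : Fin n => gaussianReal 0 1)
      (X := fun _ x => ENNReal.ofReal (Real.exp (-(c * x ^ 2) / 2)))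
      fun _ => hX.aemeasurable) fun i => hX.comp (measurable_pi_apply i)]
  have heval : ∀ i : Fin n, ∫⁻ y : Fin n → ℝ, ENNReal.ofReal (Real.exp (-(c * y i ^ 2) / 2))
      ∂Measure.pi (fun _ => gaussianReal 0 1) = ENNReal.ofReal (√(1 + c)⁻¹) := fun i => by
    rw [← lintegral_exp_neg_mul_sq_gaussianReal hc]
    exact (measurePreserving_eval (fun _ : Fin n => gaussianReal 0 1) i).lintegral_comp hX
  simp [heval]

/-- The first coordinate of a Gaussian vector is rarely large compared with the others. -/
lemma gaussianPi_mul_sum_succ_sq_le_sq_zero {n : ℕ} {c : ℝ} (hc : 0 ≤ c) :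
    gaussianPi (n + 1) {x | c * ∑ i : Fin n, x i.succ ^ 2 ≤ x 0 ^ 2}
      ≤ ENNReal.ofReal (√(1 + c)⁻¹) ^ n := by
  have hS : MeasurableSet {p : ℝ × (Fin n → ℝ) | c * ∑ i, p.2 i ^ 2 ≤ p.1 ^ 2} :=
    measurableSet_le (by fun_prop) (by fun_prop)
  have hmp := measurePreserving_piFinSuccAbove (fun _ : Fin (n + 1) => gaussianReal 0 1) 0
  calc gaussianPi (n + 1) {x | c * ∑ i : Fin n, x i.succ ^ 2 ≤ x 0 ^ 2}
      = ((gaussianReal 0 1).prod (Measure.pi fun _ : Fin n => gaussianReal 0 1))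
          {p : ℝ × (Fin n → ℝ) | c * ∑ i, p.2 i ^ 2 ≤ p.1 ^ 2} := by
        rw [← hmp.measure_preimage hS.nullMeasurableSet]
        rfl
    _ = ∫⁻ y : Fin n → ℝ, gaussianReal 0 1 {x | c * ∑ i, y i ^ 2 ≤ x ^ 2}
          ∂Measure.pi (fun _ => gaussianReal 0 1) := Measure.prod_apply_symm hS
    _ ≤ _ := lintegral_mono fun y => gaussianReal_sq_ge_le _
    _ = _ := lintegral_exp_neg_mul_sum_sq_gaussian hc

/-- Rotation invariance: the angle between `a` and a Gaussian vector is distributed as the angle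
between the first basis vector and a Gaussian vector. -/
lemma gaussianPi_le_cos_sq_eq {n : ℕ} {a : Fin (n + 1) → ℝ} (ha : a ≠ 0) (α : ℝ) :
    gaussianPi (n + 1) {h | α ≤ (dotp a h) ^ 2 / (sqNorm a * sqNorm h)}
      = gaussianPi (n + 1) {x | α ≤ x 0 ^ 2 / sqNorm x} := by
  set a' : EuclideanSpace ℝ (Fin (n + 1)) := WithLp.toLp 2 a with ha'
  have ha0 : a' ≠ 0 := by simpa [ha'] using ha
  have hna : ‖a'‖ ≠ 0 := norm_ne_zero_iff.2 ha0
  obtain ⟨b, hb⟩ := Orthonormal.exists_orthonormalBasis_extension_of_card_eq (𝕜 := ℝ)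
    (E := EuclideanSpace ℝ (Fin (n + 1))) (ι := Fin (n + 1)) (by simp)
    (v := fun _ => ‖a'‖⁻¹ • a') (s := {0}) (by
      rw [orthonormal_iff_ite]
      rintro ⟨i, rfl⟩ ⟨j, rfl⟩
      simp [norm_smul, hna])
  have hb0 : a' = ‖a'‖ • b 0 := by
    rw [hb 0 rfl, smul_inv_smul₀ hna]
  have hcoord : ∀ v : EuclideanSpace ℝ (Fin (n + 1)),
      (dotp a v.ofLp) ^ 2 / (sqNorm a * sqNorm v.ofLp)
        = (inner ℝ a' v) ^ 2 / (‖a'‖ ^ 2 * ‖v‖ ^ 2) := fun v => by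
    simp [dotp, sqNorm, EuclideanSpace.norm_sq_eq, PiLp.inner_apply, ha', mul_comm]
  have hmeas : MeasurableSet {v : EuclideanSpace ℝ (Fin (n + 1)) |
      α ≤ (inner ℝ a' v) ^ 2 / (‖a'‖ ^ 2 * ‖v‖ ^ 2)} :=
    measurableSet_le (by fun_prop) (by fun_prop)
  have hlaw := (map_pi_eq_stdGaussian (ι := Fin (n + 1))).trans
    (stdGaussian_eq_map_pi_orthonormalBasis b)
  have := congrArg (fun μ => μ {v : EuclideanSpace ℝ (Fin (n + 1)) |
      α ≤ (inner ℝ a' v) ^ 2 / (‖a'‖ ^ 2 * ‖v‖ ^ 2)}) hlaw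
  simp only at this
  rw [Measure.map_apply (by fun_prop) hmeas, Measure.map_apply (by fun_prop) hmeas] at this
  rw [gaussianPi]
  convert this using 2
  · ext x
    simp only [Set.mem_ofPred_eq, Set.mem_preimage, ← hcoord]
  · ext x
    have h1 : inner ℝ a' (∑ i, x i • b i) = ‖a'‖ * x 0 := by
      rw [hb0, inner_smul_left, b.orthonormal.inner_right_fintype]
      simp [norm_smul]
    have h2 : ‖∑ i, x i • b i‖ ^ 2 = sqNorm x := by
      rw [← real_inner_self_eq_norm_sq, b.orthonormal.inner_sum]
      simp [sqNorm, sq]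
    simp only [Set.mem_ofPred_eq, Set.mem_preimage]
    rw [h1, h2, mul_pow, mul_div_mul_left _ _ (pow_ne_zero 2 hna)]

lemma gaussianPi_le_cos_sq_le_of_lt_one {L : ℕ} (hL : 4 ≤ L) {a : Fin L → ℝ} (ha : a ≠ 0)
    {α : ℝ} (h0 : 0 ≤ α) (h1 : α < 1) :
    gaussianPi L {h | α ≤ (dotp a h) ^ 2 / (sqNorm a * sqNorm h)}
      ≤ ENNReal.ofReal ((1 - α) ^ (L / 2 - 1)) := by
  obtain ⟨n, rfl⟩ : ∃ n, L = n + 1 := ⟨L - 1, by omega⟩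
  have hpos : 0 < 1 - α := by linarith
  have hc : 0 ≤ α / (1 - α) := by positivity
  have hv : (1 + α / (1 - α))⁻¹ = 1 - α := by field_simp; ring
  rw [gaussianPi_le_cos_sq_eq ha]
  calc _ ≤ gaussianPi (n + 1) {x | α / (1 - α) * ∑ i : Fin n, x i.succ ^ 2 ≤ x 0 ^ 2} := by
        refine measure_mono fun x (hx : α ≤ x 0 ^ 2 / sqNorm x) => ?_
        have hx' : α * sqNorm x ≤ x 0 ^ 2 :=
          mul_le_of_le_div₀ (sq_nonneg _) (Finset.sum_nonneg fun _ _ => sq_nonneg _) hx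
        rw [sqNorm, Fin.sum_univ_succ] at hx'
        rw [Set.mem_ofPred_eq, div_mul_eq_mul_div, div_le_iff₀ hpos]
        linarith
    _ ≤ ENNReal.ofReal (√(1 + α / (1 - α))⁻¹) ^ n := gaussianPi_mul_sum_succ_sq_le_sq_zero hc
    _ ≤ _ := by
        rw [hv, ← ENNReal.ofReal_pow (Real.sqrt_nonneg _)]
        refine ENNReal.ofReal_le_ofReal ?_
        calc √(1 - α) ^ n ≤ √(1 - α) ^ (2 * ((n + 1) / 2 - 1)) :=
              pow_le_pow_of_le_one (Real.sqrt_nonneg _) (Real.sqrt_le_one.2 (by linarith))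
                (by omega)
          _ = _ := by rw [pow_mul, Real.sq_sqrt hpos.le]

lemma gaussianPi_le_cos_sq_le {L : ℕ} (hL : 4 ≤ L) {a : Fin L → ℝ} (ha : a ≠ 0)
    {α : ℝ} (hα : α ∈ Set.Icc (0 : ℝ) 1) :
    gaussianPi L {h | α ≤ (dotp a h) ^ 2 / (sqNorm a * sqNorm h)}
      ≤ ENNReal.ofReal ((1 - α) ^ (L / 2 - 1)) := by
  rcases hα.2.lt_or_eq with h1 | rfl
  · exact gaussianPi_le_cos_sq_le_of_lt_one hL ha hα.1 h1
  have hlim : Tendsto (fun β : ℝ => ENNReal.ofReal ((1 - β) ^ (L / 2 - 1)))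
      (nhdsWithin 1 (Set.Iio 1)) (nhds (ENNReal.ofReal ((1 - 1) ^ (L / 2 - 1)))) :=
    ((ENNReal.continuous_ofReal.comp (by fun_prop)).tendsto 1).mono_left nhdsWithin_le_nhds
  refine ge_of_tendsto hlim ?_
  filter_upwards [Ioo_mem_nhdsLT zero_lt_one] with β hβ
  refine le_trans (measure_mono fun h hh => ?_)
    (gaussianPi_le_cos_sq_le_of_lt_one hL ha hβ.1.le hβ.2)
  exact hβ.2.le.trans hh

/-- For `L ≥ 4`, a fixed nonzero `a ∈ ℝ^L` and a standard Gaussian vector `h`, the CDF of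
the squared cosine `⟨a,h⟩²/(‖a‖²‖h‖²)` is bounded below by the CDF of the minimum of
`⌊L/2⌋ − 1` i.i.d. uniform random variables on `[0,1]`:
`P(X ≤ α) ≥ 1 − (1−α)^(⌊L/2⌋−1)`, equivalently `P(X ≥ α) ≤ (1−α)^(⌊L/2⌋−1)`. -/
theorem statement6 (L : ℕ) (hL : 4 ≤ L) (a : Fin L → ℝ) (ha : a ≠ 0)
    (α : ℝ) (hα : α ∈ Set.Icc (0 : ℝ) 1) :
    ENNReal.ofReal (1 - (1 - α) ^ (L / 2 - 1))
        ≤ gaussianPi L {h | (dotp a h) ^ 2 / (sqNorm a * sqNorm h) ≤ α}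
    ∧ gaussianPi L {h | α ≤ (dotp a h) ^ 2 / (sqNorm a * sqNorm h)}
        ≤ ENNReal.ofReal ((1 - α) ^ (L / 2 - 1)) := by
  have hge := gaussianPi_le_cos_sq_le hL ha hα
  refine ⟨?_, hge⟩
  have : IsProbabilityMeasure (gaussianPi L) := by unfold gaussianPi; infer_instance
  have hmeas : MeasurableSet {h : Fin L → ℝ | (dotp a h) ^ 2 / (sqNorm a * sqNorm h) ≤ α} := by
    unfold dotp sqNorm
    exact measurableSet_le (by fun_prop) (by fun_prop)
  rw [ENNReal.ofReal_sub _ (pow_nonneg (sub_nonneg.2 hα.2) _), ENNReal.ofReal_one,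
    tsub_le_iff_right,
    ← prob_add_prob_compl (μ := gaussianPi L) hmeas]
  gcongr
  refine le_trans (measure_mono fun h hh => ?_) hge
  rw [Set.mem_compl_iff, Set.mem_ofPred_eq, not_le] at hh
  exact hh.le
end

section
/- Let P > 0, h ∈ ℝ^L, and 1 ≤ k ≤ L. Let h^s ∈ ℝ^L be a rearrangement of h sorted in ascending order of absolute value, i.e., h^s_j = h_{σ(j)} for a permutation σ with |h^s_1| ≤ |h^s_2| ≤ … ≤ |h^s_L|. Then for every subset S ⊆ {1,…,L} with |S| = k there exists an index i ∈ {1,…,L−k+1} such that R( (|h^s_i|, |h^s_{i+1}|, …, |h^s_{i+k−1}|), 𝟙 ) ≥ R( |h(S)|, 𝟙 ), where 𝟙 = (1,…,1) ∈ ℝ^k and |h(S)| ∈ ℝ^k is the vector of absolute values of the entries of h indexed by S. That is, the maximum of R(|h(S)|, 𝟙) over all k-element subsets S is attained on a window of k consecutive entries of the sorted vector h^s. -/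
lemma sum_le_sum_of_card_eq_of_forall_le {ι : Type*} [DecidableEq ι] (f : ι → ℝ)
    (W S : Finset ι) (hcard : W.card = S.card) (hf : ∀ w ∈ W, ∀ x ∉ W, f w ≤ f x) :
    ∑ w ∈ W, f w ≤ ∑ x ∈ S, f x := by
  have hsdiff : ∑ w ∈ W \ S, f w ≤ ∑ x ∈ S \ W, f x := by
    have hc : (W \ S).card = (S \ W).card := Finset.card_sdiff_comm hcard
    rcases (W \ S).eq_empty_or_nonempty with h0 | h0
    · have h1 : S \ W = ∅ := by rw [← Finset.card_eq_zero, ← hc, h0, Finset.card_empty]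
      simp [h0, h1]
    · obtain ⟨m, hm, hmax⟩ := Finset.exists_max_image (W \ S) f h0
      calc ∑ w ∈ W \ S, f w ≤ (W \ S).card • f m := Finset.sum_le_card_nsmul _ _ _ hmax
        _ = (S \ W).card • f m := by rw [hc]
        _ ≤ ∑ x ∈ S \ W, f x := Finset.card_nsmul_le_sum _ _ _ fun x hx =>
          hf m (Finset.mem_sdiff.1 hm).1 x (Finset.mem_sdiff.1 hx).2
  rw [← Finset.sum_inter_add_sum_sdiff W S f, ← Finset.sum_inter_add_sum_sdiff S W f,
    Finset.inter_comm S W]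
  gcongr

/-- For a monotone sequence `u`, some window of `k` consecutive entries has no entry larger in
absolute value than an entry outside of it. -/
lemma exists_window_sq_le {L k : ℕ} (hk : 1 ≤ k) (hkL : k ≤ L) (u : Fin L → ℝ)
    (hu : Monotone u) :
    ∃ i : ℕ, i + k ≤ L ∧ ∀ w x : Fin L, i ≤ w.1 → w.1 < i + k →
      (x.1 < i ∨ i + k ≤ x.1) → u w ^ 2 ≤ u x ^ 2 := by
  classical
  let p : ℕ → Prop := fun i => ∀ hi : i + k < L, 0 ≤ u ⟨i, by omega⟩ + u ⟨i + k, hi⟩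
  have hp : ∃ i, p i := ⟨L - k, fun hi => by omega⟩
  have hle : Nat.find hp ≤ L - k := Nat.find_min' hp fun hi => by omega
  refine ⟨Nat.find hp, by omega, fun w x hw1 hw2 hx => ?_⟩
  rw [sq_le_sq]
  rcases hx with hx | hx
  · have hmin := Nat.find_min hp (m := Nat.find hp - 1) (by omega)
    simp only [p, not_forall, not_le] at hmin
    obtain ⟨hi, hneg⟩ := hmin
    have h1 : u x ≤ u ⟨Nat.find hp - 1, by omega⟩ := hu (Fin.mk_le_mk.2 (by omega))
    have h2 : u ⟨Nat.find hp - 1, by omega⟩ ≤ u w := hu (Fin.mk_le_mk.2 (by omega))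
    have h3 : u w ≤ u ⟨Nat.find hp - 1 + k, hi⟩ := hu (Fin.mk_le_mk.2 (by omega))
    exact (abs_le.2 ⟨by linarith, by linarith⟩ : |u w| ≤ -u x).trans (neg_le_abs _)
  · have hi := Nat.find_spec hp (by omega)
    have h1 : u ⟨Nat.find hp + k, by omega⟩ ≤ u x := hu (Fin.mk_le_mk.2 (by omega))
    have h2 : u ⟨Nat.find hp, by omega⟩ ≤ u w := hu (Fin.mk_le_mk.2 (by omega))
    have h3 : u w ≤ u ⟨Nat.find hp + k, by omega⟩ := hu (Fin.mk_le_mk.2 (by omega))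
    exact (abs_le.2 ⟨by linarith, by linarith⟩ : |u w| ≤ u x).trans (le_abs_self _)

lemma exists_window_sum_sq_le {L k : ℕ} (hk : 1 ≤ k) (hkL : k ≤ L) (u : Fin L → ℝ)
    (hu : Monotone u) :
    ∃ i : ℕ, ∃ hik : i + k ≤ L, ∀ s : Fin k → Fin L, Function.Injective s →
      ∑ j : Fin k, u ⟨i + j.1, lt_of_lt_of_le (Nat.add_lt_add_left j.2 i) hik⟩ ^ 2
        ≤ ∑ j, u (s j) ^ 2 := by
  obtain ⟨i, hik, hi⟩ := exists_window_sq_le hk hkL u hu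
  refine ⟨i, hik, fun s hs => ?_⟩
  let w : Fin k → Fin L := fun j => ⟨i + j.1, lt_of_lt_of_le (Nat.add_lt_add_left j.2 i) hik⟩
  have hw : Function.Injective w := fun a b hab => by
    have := congrArg Fin.val hab
    simp only [w] at this
    exact Fin.ext (by omega)
  have key := sum_le_sum_of_card_eq_of_forall_le (fun x => u x ^ 2)
    (Finset.univ.image w) (Finset.univ.image s)
    (by rw [Finset.card_image_of_injective _ hw, Finset.card_image_of_injective _ hs]) (by
      intro a ha x hx
      obtain ⟨j, -, rfl⟩ := Finset.mem_image.1 ha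
      refine hi _ _ (Nat.le_add_right _ _) (Nat.add_lt_add_left j.2 i) ?_
      by_contra! hcon
      refine hx (Finset.mem_image.2 ⟨⟨x.1 - i, by omega⟩, Finset.mem_univ _, Fin.ext ?_⟩)
      simp only [w]
      omega)
  rwa [Finset.sum_image hw.injOn, Finset.sum_image hs.injOn] at key

lemma sqNorm_nonneg {n : ℕ} (v : Fin n → ℝ) : 0 ≤ sqNorm v :=
  Finset.sum_nonneg fun _ _ => sq_nonneg _

lemma sum_mul_sub_sq {n : ℕ} (α : ℝ) (v a : Fin n → ℝ) :
    ∑ i, (α * v i - a i) ^ 2 = α ^ 2 * sqNorm v - 2 * α * dotp v a + sqNorm a := by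
  simp only [sqNorm, dotp, Finset.mul_sum, ← Finset.sum_sub_distrib, ← Finset.sum_add_distrib]
  exact Finset.sum_congr rfl fun i _ => by ring

lemma dotp_sq_le {n : ℕ} (v a : Fin n → ℝ) : dotp v a ^ 2 ≤ sqNorm v * sqNorm a :=
  Finset.sum_mul_sq_le_sq_mul_sq _ _ _

lemma noise_pos {n : ℕ} {P : ℝ} (hP : 0 < P) (v a : Fin n → ℝ) (ha : 0 < sqNorm a) :
    0 < sqNorm a - P * dotp v a ^ 2 / (1 + P * sqNorm v) := by
  have hq := sqNorm_nonneg v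
  rw [sub_pos, div_lt_iff₀ (by positivity)]
  nlinarith [mul_le_mul_of_nonneg_left (dotp_sq_le v a) hP.le]

lemma noise_le {n : ℕ} {P : ℝ} (hP : 0 < P) (v a : Fin n → ℝ) (α : ℝ) :
    sqNorm a - P * dotp v a ^ 2 / (1 + P * sqNorm v)
      ≤ α ^ 2 / P + ∑ i, (α * v i - a i) ^ 2 := by
  have hD : 0 < 1 + P * sqNorm v := by have := sqNorm_nonneg v; positivity
  rw [sum_mul_sub_sq, ← sub_nonneg]
  have : α ^ 2 / P + (α ^ 2 * sqNorm v - 2 * α * dotp v a + sqNorm a)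
      - (sqNorm a - P * dotp v a ^ 2 / (1 + P * sqNorm v))
      = (α * (1 + P * sqNorm v) - P * dotp v a) ^ 2 / (P * (1 + P * sqNorm v)) := by
    field_simp
    ring
  rw [this]
  positivity

lemma noise_eq_mmse {n : ℕ} {P : ℝ} (hP : 0 < P) (v a : Fin n → ℝ) :
    (P * dotp v a / (1 + P * sqNorm v)) ^ 2 / P
        + ∑ i, (P * dotp v a / (1 + P * sqNorm v) * v i - a i) ^ 2
      = sqNorm a - P * dotp v a ^ 2 / (1 + P * sqNorm v) := by
  have hD : 0 < 1 + P * sqNorm v := by have := sqNorm_nonneg v; positivity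
  rw [sum_mul_sub_sq]
  field_simp
  ring

lemma Rcf_le_Rcf {n : ℕ} {P : ℝ} (hP : 0 < P) (v w a : Fin n → ℝ) (ha : 0 < sqNorm a)
    (hvw : sqNorm a - P * dotp w a ^ 2 / (1 + P * sqNorm w)
      ≤ sqNorm a - P * dotp v a ^ 2 / (1 + P * sqNorm v)) :
    Rcf P v a ≤ Rcf P w a := by
  have hw := noise_pos hP w a ha
  have hv := noise_pos hP v a ha
  unfold Rcf logPlus
  gcongr
  norm_num

/-- Sort `h` by absolute value via a permutation `σ` (so `j ↦ |h(σ j)|` is monotone).  For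
every `k`-element subset of the users (given by an injective `e : Fin k → Fin L`), there is
a window of `k` consecutive entries of the sorted vector achieving at least the rate of that
subset for the all-ones coefficient vector.  Hence the maximum of `R(|h(S)|, 𝟙)` over
`k`-subsets `S` is attained on a window of consecutive entries of the sorted vector. -/
theorem statement11 (P : ℝ) (hP : 0 < P) (L k : ℕ) (hk1 : 1 ≤ k) (hkL : k ≤ L)
    (h : Fin L → ℝ) (σ : Equiv.Perm (Fin L))
    (hσ : Monotone fun j : Fin L => |h (σ j)|)
    (e : Fin k → Fin L) (he : Function.Injective e) :
    ∃ i : ℕ, ∃ hik : i + k ≤ L,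
      Rcf P (fun j : Fin k =>
          |h (σ ⟨i + j.1, lt_of_lt_of_le (Nat.add_lt_add_left j.2 i) hik⟩)|)
          (fun _ => (1 : ℝ))
        ≥ Rcf P (fun j : Fin k => |h (e j)|) (fun _ => (1 : ℝ)) := by
  set a : Fin k → ℝ := fun _ => 1 with ha_def
  set v : Fin k → ℝ := fun j => |h (e j)| with hv_def
  have ha : 0 < sqNorm a := by
    simp only [sqNorm, ha_def, one_pow, Finset.sum_const, Finset.card_univ, Fintype.card_fin,
      nsmul_eq_mul, mul_one, Nat.cast_pos]
    omega
  set α := P * dotp v a / (1 + P * sqNorm v) with hα_def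
  have hα : 0 ≤ α := by
    have h1 : 0 ≤ dotp v a := Finset.sum_nonneg fun i _ => by simp [v, a]
    have h2 := sqNorm_nonneg v
    positivity
  obtain ⟨i, hik, hi⟩ := exists_window_sum_sq_le hk1 hkL (fun j => α * |h (σ j)| - 1)
    fun x y hxy => sub_le_sub_right (mul_le_mul_of_nonneg_left (hσ hxy) hα) 1
  refine ⟨i, hik, Rcf_le_Rcf hP _ _ a ha ?_⟩
  have hsum := hi (fun j => σ.symm (e j)) (σ.symm.injective.comp he)
  simp only [Equiv.apply_symm_apply] at hsum
  refine (noise_le hP _ a α).trans ?_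
  rw [← noise_eq_mmse hP v a, ← hα_def]
  gcongr
end

section
/- Let P > 0, h ∈ ℝ^L, and let a ∈ ℤ^L be a nonzero integer vector. Then ‖a‖² − P⟨h,a⟩²/(1+P‖h‖²) ≥ 1/(1 + P·max_{1≤i≤L} h_i²), and consequently the CF computation rate satisfies the universal upper bound R(h,a) ≤ (1/2)·log₂( 1 + P·max_{1≤i≤L} h_i² ). -/
/-- Completing the square in the quadratic form `‖a‖² − P⟨h,a⟩²/(1+P‖h‖²)`. -/
lemma sqNorm_sub_eq_sum_sq_add {L : ℕ} {P : ℝ} (hP : 0 < P) (h a : Fin L → ℝ) :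
    sqNorm a - P * (dotp h a) ^ 2 / (1 + P * sqNorm h)
      = ∑ i, (a i - P * dotp h a / (1 + P * sqNorm h) * h i) ^ 2
        + (P * dotp h a / (1 + P * sqNorm h)) ^ 2 / P := by
  have hD : 1 + P * sqNorm h ≠ 0 := by
    have : 0 ≤ sqNorm h := Finset.sum_nonneg fun i _ => sq_nonneg (h i)
    positivity
  have expand (t : ℝ) :
      ∑ i, (a i - t * h i) ^ 2 = sqNorm a - 2 * t * dotp h a + t ^ 2 * sqNorm h := by
    simp only [sqNorm, dotp, Finset.mul_sum, ← Finset.sum_sub_distrib, ← Finset.sum_add_distrib]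
    exact Finset.sum_congr rfl fun i _ => by ring
  rw [expand]
  field_simp
  ring

/-- Each coordinate of `a` bounds the quadratic form `‖a‖² − P⟨h,a⟩²/(1+P‖h‖²)` from below. -/
lemma sq_div_le_sqNorm_sub {L : ℕ} {P : ℝ} (hP : 0 < P) (h a : Fin L → ℝ) (j : Fin L) :
    a j ^ 2 / (1 + P * h j ^ 2) ≤ sqNorm a - P * (dotp h a) ^ 2 / (1 + P * sqNorm h) := by
  rw [sqNorm_sub_eq_sum_sq_add hP]
  generalize P * dotp h a / (1 + P * sqNorm h) = t
  have single : (a j - t * h j) ^ 2 ≤ ∑ i, (a i - t * h i) ^ 2 :=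
    Finset.single_le_sum (f := fun i => (a i - t * h i) ^ 2)
      (fun i _ => sq_nonneg _) (Finset.mem_univ j)
  refine le_trans ?_ (add_le_add_left single _)
  rw [div_le_iff₀ (by positivity)]
  have key : ((a j - t * h j) ^ 2 + t ^ 2 / P) * (1 + P * h j ^ 2)
      = a j ^ 2 + (P * h j * (a j - t * h j) - t) ^ 2 / P := by
    field_simp
    ring
  rw [key]
  exact le_add_of_nonneg_right (by positivity)

/-- Universal upper bound on the computation rate: for any nonzero integer coefficient
vector `a`, `‖a‖² − P⟨h,a⟩²/(1+P‖h‖²) ≥ 1/(1+P·maxᵢ hᵢ²)`, and consequently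
`R(h,a) ≤ (1/2)·log₂(1+P·maxᵢ hᵢ²)`. -/
theorem statement12 (L : ℕ) (P : ℝ) (hP : 0 < P) (h : Fin L → ℝ)
    (a : Fin L → ℤ) (ha : a ≠ 0) :
    (1 + P * ⨆ i : Fin L, (h i) ^ 2)⁻¹
        ≤ sqNorm (fun i => (a i : ℝ))
            - P * (dotp h fun i => (a i : ℝ)) ^ 2 / (1 + P * sqNorm h)
    ∧ Rcf P h (fun i => (a i : ℝ))
        ≤ (1 / 2) * Real.logb 2 (1 + P * ⨆ i : Fin L, (h i) ^ 2) := by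
  obtain ⟨j, hj⟩ := Function.ne_iff.mp ha
  have le_sup : h j ^ 2 ≤ ⨆ i : Fin L, (h i) ^ 2 :=
    le_ciSup (f := fun i => (h i) ^ 2) (Set.finite_range _).bddAbove j
  have sup_nonneg : 0 ≤ ⨆ i : Fin L, (h i) ^ 2 := (sq_nonneg _).trans le_sup
  have one_le : (1 : ℝ) ≤ (a j : ℝ) ^ 2 := by
    exact_mod_cast Int.one_le_abs (sq_pos_of_ne_zero hj).ne' |>.trans_eq (abs_sq _)
  have bound : (1 + P * ⨆ i : Fin L, (h i) ^ 2)⁻¹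
      ≤ sqNorm (fun i => (a i : ℝ))
        - P * (dotp h fun i => (a i : ℝ)) ^ 2 / (1 + P * sqNorm h) := by
    refine le_trans ?_ (sq_div_le_sqNorm_sub hP h (fun i => (a i : ℝ)) j)
    rw [inv_eq_one_div]
    gcongr
  refine ⟨bound, ?_⟩
  have pos : 0 < 1 + P * ⨆ i : Fin L, (h i) ^ 2 := by positivity
  have form_pos := (inv_pos.mpr pos).trans_le bound
  unfold Rcf logPlus
  gcongr
  refine max_le ?_ (Real.logb_nonneg one_lt_two (by nlinarith))
  exact Real.logb_le_logb_of_le one_lt_two (inv_pos.mpr form_pos)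
    (inv_le_of_inv_le₀ pos bound)
end

section
/- Let P > 0, k ≥ 1 an integer, u > 0 and δ > 0, and let h ∈ ℝ^k satisfy u ≤ h_i ≤ u + δ for all i. Then: (i) ‖h‖² ≥ k·u²; (ii) ⟨h,𝟙⟩²/(k‖h‖²) ≥ u²/(u+δ)², where 𝟙 = (1,…,1) ∈ ℝ^k; and (iii) the CF computation rate for the all-ones coefficient vector satisfies R(h, 𝟙) ≥ (1/2)·log⁺( ( k·(1 − P·k·u⁴ / ((u+δ)²·(1 + P·k·u²))) )⁻¹ ). -/
theorem logPlus_mono {x y : ℝ} (hx : 0 < x) (hxy : x ≤ y) : logPlus x ≤ logPlus y :=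
  max_le_max (Real.logb_le_logb_of_le one_lt_two hx hxy) le_rfl

/-- If all channel gains lie in the band `[u, u+δ]` then: (i) `‖h‖² ≥ k·u²`;
(ii) `cos²θ = ⟨h,𝟙⟩²/(k‖h‖²) ≥ u²/(u+δ)²`; and (iii) the computation rate for the
all-ones coefficient vector satisfies
`R(h,𝟙) ≥ (1/2)·log⁺((k(1 − P·k·u⁴/((u+δ)²(1+P·k·u²))))⁻¹)`. -/
theorem statement13 (P : ℝ) (hP : 0 < P) (k : ℕ) (hk : 1 ≤ k)
    (u δ : ℝ) (hu : 0 < u) (hδ : 0 < δ)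
    (h : Fin k → ℝ) (hband : ∀ i, u ≤ h i ∧ h i ≤ u + δ) :
    (k : ℝ) * u ^ 2 ≤ sqNorm h
    ∧ u ^ 2 / (u + δ) ^ 2 ≤ (dotp h fun _ => (1 : ℝ)) ^ 2 / ((k : ℝ) * sqNorm h)
    ∧ (1 / 2) * logPlus
          (((k : ℝ) * (1 - P * k * u ^ 4 / ((u + δ) ^ 2 * (1 + P * k * u ^ 2))))⁻¹)
        ≤ Rcf P h (fun _ => (1 : ℝ)) := by
  have hk0 : (0 : ℝ) < k := by exact_mod_cast hk
  have hv : 0 < u + δ := by positivity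
  have hS_lower : (k : ℝ) * u ^ 2 ≤ sqNorm h := by
    simpa [sqNorm] using Finset.card_nsmul_le_sum Finset.univ (fun i => h i ^ 2) (u ^ 2)
      fun i _ => pow_le_pow_left₀ hu.le (hband i).1 2
  have hS_upper : sqNorm h ≤ k * (u + δ) ^ 2 := by
    simpa [sqNorm] using Finset.sum_le_card_nsmul Finset.univ (fun i => h i ^ 2) ((u + δ) ^ 2)
      fun i _ => pow_le_pow_left₀ (hu.le.trans (hband i).1) (hband i).2 2
  have hT_lower : (k : ℝ) * u ≤ dotp h fun _ => (1 : ℝ) := by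
    simpa [dotp] using Finset.card_nsmul_le_sum Finset.univ h u fun i _ => (hband i).1
  have cauchy_schwarz : (dotp h fun _ => (1 : ℝ)) ^ 2 ≤ k * sqNorm h := by
    simpa [dotp, sqNorm] using sq_sum_le_card_mul_sum_sq (s := Finset.univ) (f := h)
  have hone : sqNorm (fun _ : Fin k => (1 : ℝ)) = k := by simp [sqNorm]
  have hS : 0 < sqNorm h := lt_of_lt_of_le (by positivity) hS_lower
  rw [Rcf, hone]
  generalize (dotp h fun _ => (1 : ℝ)) = T at *
  generalize sqNorm h = S at *
  have hcos : u ^ 2 * (k * S) ≤ T ^ 2 * (u + δ) ^ 2 := by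
    calc u ^ 2 * (k * S) ≤ u ^ 2 * (k * (k * (u + δ) ^ 2)) := by gcongr
      _ = (k * u) ^ 2 * (u + δ) ^ 2 := by ring
      _ ≤ T ^ 2 * (u + δ) ^ 2 := by gcongr
  refine ⟨hS_lower, (div_le_div_iff₀ (by positivity) (by positivity)).2 hcos, ?_⟩
  have hpos : 0 < k - P * T ^ 2 / (1 + P * S) := by
    rw [sub_pos, div_lt_iff₀ (by positivity)]
    nlinarith [mul_le_mul_of_nonneg_left cauchy_schwarz hP.le]
  have hbound : P * (k * u ^ 2) * (k * u ^ 2) / ((u + δ) ^ 2 * (1 + P * (k * u ^ 2)))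
      ≤ P * T ^ 2 / (1 + P * S) := by
    calc P * (k * u ^ 2) * (k * u ^ 2) / ((u + δ) ^ 2 * (1 + P * (k * u ^ 2)))
        ≤ P * (k * u ^ 2) * S / ((u + δ) ^ 2 * (1 + P * S)) := by
          rw [div_le_div_iff₀ (by positivity) (by positivity)]
          have : 0 ≤ P * (k * u ^ 2) * (u + δ) ^ 2 := by positivity
          nlinarith [mul_le_mul_of_nonneg_left hS_lower this]
      _ = P * (u ^ 2 * (k * S)) / ((u + δ) ^ 2 * (1 + P * S)) := by ring
      _ ≤ P * (T ^ 2 * (u + δ) ^ 2) / ((u + δ) ^ 2 * (1 + P * S)) := by gcongr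
      _ = P * T ^ 2 / (1 + P * S) := by field_simp
  refine mul_le_mul_of_nonneg_left ?_ (by norm_num)
  have hle : k - P * T ^ 2 / (1 + P * S)
      ≤ k * (1 - P * k * u ^ 4 / ((u + δ) ^ 2 * (1 + P * k * u ^ 2))) := by
    calc k - P * T ^ 2 / (1 + P * S)
        ≤ k - P * (k * u ^ 2) * (k * u ^ 2) / ((u + δ) ^ 2 * (1 + P * (k * u ^ 2))) :=
          sub_le_sub_left hbound _
      _ = k * (1 - P * k * u ^ 4 / ((u + δ) ^ 2 * (1 + P * k * u ^ 2))) := by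
          rw [← mul_assoc P]; ring
  exact logPlus_mono (inv_pos.2 (hpos.trans_le hle)) (inv_anti₀ hpos hle)
end

section
/- Let L be an integer, δ = 1/ln L, and suppose L is large enough that δ√L/√(2π) > 1 and u := √(2·ln(δ√L/√(2π))) − δ ≥ 0. Then the probability that a standard normal random variable falls in [−(u+δ),−u] ∪ [u, u+δ] satisfies p(u,δ) := 2(Φ(u+δ) − Φ(u)) ≥ 2/√L, where Φ is the standard normal cumulative distribution function. -/
open MeasureTheory ProbabilityTheory

/-- The standard normal cumulative distribution function `Φ`. -/
noncomputable def stdNormalCDF (x : ℝ) : ℝ :=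
  ∫ t in Set.Iic x, gaussianPDFReal 0 1 t

lemma antitoneOn_gaussianPDFReal_zero_one :
    AntitoneOn (gaussianPDFReal 0 1) (Set.Ici 0) := by
  intro x hx y _ hxy
  have hx : (0 : ℝ) ≤ x := hx
  simp only [gaussianPDFReal, sub_zero, NNReal.coe_one, mul_one]
  gcongr

lemma mul_gaussianPDFReal_le_stdNormalCDF_sub {u δ : ℝ} (hu : 0 ≤ u) (hδ : 0 ≤ δ) :
    δ * gaussianPDFReal 0 1 (u + δ) ≤ stdNormalCDF (u + δ) - stdNormalCDF u := by
  have hint := integrable_gaussianPDFReal 0 1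
  unfold stdNormalCDF
  rw [intervalIntegral.integral_Iic_sub_Iic hint.integrableOn hint.integrableOn]
  calc δ * gaussianPDFReal 0 1 (u + δ)
      = ∫ _ in u..(u + δ), gaussianPDFReal 0 1 (u + δ) := by simp
    _ ≤ ∫ t in u..(u + δ), gaussianPDFReal 0 1 t := by
      refine intervalIntegral.integral_mono_on (by linarith) (by simp)
        hint.intervalIntegrable fun t ht ↦ ?_
      exact antitoneOn_gaussianPDFReal_zero_one (hu.trans ht.1) (add_nonneg hu hδ) ht.2

lemma gaussianPDFReal_zero_one_sqrt_two_mul_log {a : ℝ} (ha : 1 ≤ a) :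
    gaussianPDFReal 0 1 (√(2 * Real.log a)) = (√(2 * Real.pi))⁻¹ * a⁻¹ := by
  have hlog := Real.log_nonneg ha
  simp only [gaussianPDFReal, sub_zero, NNReal.coe_one, mul_one]
  rw [Real.sq_sqrt (by positivity), neg_div, mul_div_cancel_left₀ _ two_ne_zero, Real.exp_neg,
    Real.exp_log (by linarith)]

/-- With `δ = 1/ln L` and `u = √(2·ln(δ√L/√(2π))) − δ` (assumed well defined and
nonnegative), the probability that a standard normal falls in
`[−(u+δ),−u] ∪ [u,u+δ]`, namely `p(u,δ) = 2(Φ(u+δ) − Φ(u))`, is at least `2/√L`. -/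
theorem statement14 (L : ℕ) (δ u : ℝ)
    (hδdef : δ = 1 / Real.log L)
    (hudef : u = Real.sqrt (2 * Real.log (δ * Real.sqrt L / Real.sqrt (2 * Real.pi))) - δ)
    (h1 : 1 < δ * Real.sqrt L / Real.sqrt (2 * Real.pi))
    (h2 : 0 ≤ u) :
    2 / Real.sqrt L ≤ 2 * (stdNormalCDF (u + δ) - stdNormalCDF u) := by
  have hpi : 0 < √(2 * Real.pi) := by positivity
  have hprod : 0 < δ * √(L : ℝ) := by
    by_contra! h
    linarith [div_nonpos_of_nonpos_of_nonneg h hpi.le]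
  have hδ : 0 < δ := pos_of_mul_pos_left hprod (Real.sqrt_nonneg _)
  have hL : 0 < √(L : ℝ) := pos_of_mul_pos_right hprod hδ.le
  have key := mul_gaussianPDFReal_le_stdNormalCDF_sub h2 hδ.le
  have hsum : u + δ = √(2 * Real.log (δ * √(L : ℝ) / √(2 * Real.pi))) := by linarith
  have heq : δ * gaussianPDFReal 0 1 (u + δ) = 1 / √(L : ℝ) := by
    rw [hsum, gaussianPDFReal_zero_one_sqrt_two_mul_log h1.le]
    field_simp
  rw [heq] at key
  calc 2 / √(L : ℝ) = 2 * (1 / √(L : ℝ)) := by ring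
    _ ≤ _ := by gcongr
end

section
/- For each L, set δ_L = 1/ln L, u_L = √(2·ln(δ_L√L/√(2π))) − δ_L, and k_L = ⌈ln L⌉ + 1. For each L, let h^(1), …, h^(L) be independent standard Gaussian random vectors in ℝ^L. Let ξ_L be the event that for every n ∈ {1,…,L} the vector h^(n) has at least k_L coordinates whose values lie in [−(u_L+δ_L), −u_L] ∪ [u_L, u_L+δ_L]. Then lim_{L→∞} P(ξ_L) = 1. -/
open MeasureTheory ProbabilityTheory Filter

/-- `δ_L = 1/ln L`. -/
noncomputable def deltaL (L : ℕ) : ℝ := 1 / Real.log L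

/-- `u_L = √(2·ln(δ_L√L/√(2π))) − δ_L`. -/
noncomputable def uL (L : ℕ) : ℝ :=
  Real.sqrt (2 * Real.log (deltaL L * Real.sqrt L / Real.sqrt (2 * Real.pi))) - deltaL L

/-- `k_L = ⌈ln L⌉ + 1`. -/
noncomputable def kL (L : ℕ) : ℕ := ⌈Real.log L⌉₊ + 1

/-- The joint law of `L` independent standard Gaussian random vectors in `ℝ^L`. -/
noncomputable def gaussianSlots (L : ℕ) : Measure (Fin L → Fin L → ℝ) :=
  Measure.pi fun _ => Measure.pi fun _ => gaussianReal 0 1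

/-- Exponential Markov bound for the number of coordinates of an i.i.d. vector falling in `S`. -/
theorem measureReal_pi_card_lt_le {ι : Type*} [Fintype ι] (μ : Measure ℝ) [IsProbabilityMeasure μ]
    {S : Set ℝ} [DecidablePred (· ∈ S)] (hS : MeasurableSet S) (k : ℕ) :
    (Measure.pi fun _ : ι => μ).real {x | (Finset.univ.filter fun i => x i ∈ S).card < k} ≤
      2 ^ k * Real.exp (-(Fintype.card ι * μ.real S / 2)) := by
  set f : ℝ → ℝ := fun y => if y ∈ S then 1 / 2 else 1 with hf
  have hfm : Measurable f := Measurable.ite hS measurable_const measurable_const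
  have hf0 : ∀ y, 0 ≤ f y := fun y => by simp only [hf]; split_ifs <;> norm_num
  have hf1 : ∀ y, f y ≤ 1 := fun y => by simp only [hf]; split_ifs <;> norm_num
  have hprod : ∀ x : ι → ℝ,
      ∏ i, f (x i) = (1 / 2) ^ (Finset.univ.filter fun i => x i ∈ S).card := fun x => by
    simp [hf, Finset.prod_ite]
  have hint : ∫ y, f y ∂μ = 1 - μ.real S / 2 := by
    have : f = fun y => 1 - S.indicator (fun _ => (1 / 2 : ℝ)) y := by
      ext y
      simp only [hf, Set.indicator_apply]
      split_ifs <;> norm_num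
    rw [this, integral_sub (integrable_const _) ((integrable_const _).indicator hS),
      integral_indicator_const _ hS]
    simp
    ring
  have hInt : Integrable (fun x : ι → ℝ => ∏ i, f (x i)) (Measure.pi fun _ => μ) := by
    refine Integrable.of_bound (C := 1) ?_ (ae_of_all _ fun x => ?_)
    · exact (Finset.measurable_prod _ fun i _ =>
        hfm.comp (measurable_pi_apply i)).aestronglyMeasurable
    · rw [Real.norm_of_nonneg (Finset.prod_nonneg fun i _ => hf0 _)]
      exact Finset.prod_le_one (fun i _ => hf0 _) fun i _ => hf1 _
  have hmarkov := mul_meas_ge_le_integral_of_nonneg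
    (ae_of_all _ fun x => Finset.prod_nonneg fun i _ => hf0 (x i)) hInt ((1 / 2 : ℝ) ^ k)
  rw [integral_fintype_prod_eq_pow, hint] at hmarkov
  have hsub : (Measure.pi fun _ : ι => μ).real {x | (Finset.univ.filter fun i => x i ∈ S).card < k}
      ≤ (Measure.pi fun _ : ι => μ).real {x | (1 / 2 : ℝ) ^ k ≤ ∏ i, f (x i)} := by
    refine measureReal_mono fun x hx => ?_
    simp only [Set.mem_ofPred_eq, hprod] at hx ⊢
    exact pow_le_pow_of_le_one (by norm_num) (by norm_num) hx.le
  have hexp : (1 - μ.real S / 2) ^ Fintype.card ι ≤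
      Real.exp (-(Fintype.card ι * μ.real S / 2)) := by
    have h1 : μ.real S ≤ 1 := measureReal_le_one
    calc (1 - μ.real S / 2) ^ Fintype.card ι ≤ Real.exp (-(μ.real S / 2)) ^ Fintype.card ι :=
          pow_le_pow_left₀ (by linarith) (Real.one_sub_le_exp_neg _) _
      _ = _ := by rw [← Real.exp_nat_mul]; ring_nf
  calc _ ≤ _ := hsub
    _ = 2 ^ k * ((1 / 2) ^ k *
          (Measure.pi fun _ : ι => μ).real {x | (1 / 2 : ℝ) ^ k ≤ ∏ i, f (x i)}) := by
        rw [← mul_assoc, ← mul_pow]; norm_num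
    _ ≤ _ := by gcongr; exact hmarkov.trans hexp

/-- The standard Gaussian measure of an interval inside `[-T, T]` is at least its length times the
density at `T`. -/
theorem mul_exp_le_gaussianReal_Icc {u T : ℝ} (hu : -T ≤ u) :
    (T - u) * ((Real.sqrt (2 * Real.pi))⁻¹ * Real.exp (-(T ^ 2 / 2))) ≤
      (gaussianReal 0 1).real (Set.Icc u T) := by
  have h : ENNReal.ofReal ((T - u) * ((Real.sqrt (2 * Real.pi))⁻¹ * Real.exp (-(T ^ 2 / 2)))) ≤
      gaussianReal 0 1 (Set.Icc u T) := by
    rw [gaussianReal_apply _ one_ne_zero, mul_comm, ENNReal.ofReal_mul (by positivity),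
      ← Real.volume_Icc, ← setLIntegral_const]
    refine setLIntegral_mono' measurableSet_Icc fun x hx => ENNReal.ofReal_le_ofReal ?_
    have hx2 : x ^ 2 ≤ T ^ 2 := sq_le_sq' (hu.trans hx.1) hx.2
    simp only [gaussianPDFReal, NNReal.coe_one, mul_one, sub_zero]
    gcongr
    linarith
  rwa [ENNReal.ofReal_le_iff_le_toReal (measure_ne_top _ _)] at h

theorem tendsto_deltaL : Tendsto deltaL atTop (nhds 0) := by
  refine (Real.tendsto_log_atTop.comp
    tendsto_natCast_atTop_atTop).inv_tendsto_atTop.congr fun L => ?_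
  simp [deltaL]

theorem tendsto_deltaL_mul_sqrt_div :
    Tendsto (fun L : ℕ => deltaL L * Real.sqrt L / Real.sqrt (2 * Real.pi)) atTop atTop := by
  refine Tendsto.atTop_div_const (by positivity) ?_
  have h := (isLittleO_log_rpow_atTop (r := 1 / 2) (by norm_num)).tendsto_div_nhds_zero
  have h2 : Tendsto (fun x : ℝ => Real.log x / x ^ (1 / 2 : ℝ)) atTop (nhdsWithin 0 (Set.Ioi 0)) :=
    tendsto_nhdsWithin_iff.2 ⟨h, by
      filter_upwards [eventually_gt_atTop 1] with x hx
      exact div_pos (Real.log_pos hx) (by positivity)⟩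
  refine (h2.inv_tendsto_nhdsGT_zero.comp tendsto_natCast_atTop_atTop).congr fun L => ?_
  simp [deltaL, Real.sqrt_eq_rpow, div_eq_mul_inv, mul_comm]

theorem eventually_inv_sqrt_le_gaussianReal :
    ∀ᶠ L : ℕ in atTop, (Real.sqrt L)⁻¹ ≤
      (gaussianReal 0 1).real {y | uL L ≤ |y| ∧ |y| ≤ uL L + deltaL L} := by
  have hT : Tendsto (fun L : ℕ => Real.sqrt
      (2 * Real.log (deltaL L * Real.sqrt L / Real.sqrt (2 * Real.pi)))) atTop atTop :=
    Real.tendsto_sqrt_atTop.comp ((Real.tendsto_log_atTop.comp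
      tendsto_deltaL_mul_sqrt_div).const_mul_atTop two_pos)
  filter_upwards [hT.eventually_ge_atTop 1, tendsto_deltaL.eventually_le_const one_pos,
    tendsto_deltaL_mul_sqrt_div.eventually_ge_atTop 1, eventually_gt_atTop 1] with L h1 h2 h3 h4
  have hL : (1 : ℝ) < L := by exact_mod_cast h4
  have hδ : 0 < deltaL L := one_div_pos.2 (Real.log_pos hL)
  have hs : 0 < Real.sqrt L := Real.sqrt_pos.2 (by linarith)
  have hp : 0 < Real.sqrt (2 * Real.pi) := by positivity
  unfold uL
  set T := Real.sqrt (2 * Real.log (deltaL L * Real.sqrt L / Real.sqrt (2 * Real.pi))) with hTdef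
  have hTsq : T ^ 2 = 2 * Real.log (deltaL L * Real.sqrt L / Real.sqrt (2 * Real.pi)) :=
    Real.sq_sqrt (mul_nonneg two_pos.le (Real.log_nonneg h3))
  have hexp : Real.exp (-(T ^ 2 / 2)) = (deltaL L * Real.sqrt L / Real.sqrt (2 * Real.pi))⁻¹ := by
    rw [hTsq, mul_div_cancel_left₀ _ two_ne_zero, Real.exp_neg, Real.exp_log (by linarith)]
  have h := mul_exp_le_gaussianReal_Icc (u := T - deltaL L) (T := T) (by linarith)
  rw [hexp] at h
  have he : (T - (T - deltaL L)) * ((Real.sqrt (2 * Real.pi))⁻¹ *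
      (deltaL L * Real.sqrt L / Real.sqrt (2 * Real.pi))⁻¹) = (Real.sqrt L)⁻¹ := by
    field_simp
    ring
  rw [he] at h
  refine h.trans (measureReal_mono fun x hx => ?_)
  have hx0 : 0 ≤ x := by linarith [hx.1]
  simpa [abs_of_nonneg hx0] using hx

theorem two_pow_kL_le {L : ℕ} (hL : 1 ≤ L) : (2 : ℝ) ^ kL L ≤ Real.exp 2 * L := by
  have hL' : (1 : ℝ) ≤ L := by exact_mod_cast hL
  have h2 : (2 : ℝ) ≤ Real.exp 1 := by linarith [Real.add_one_le_exp 1]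
  have hk : (kL L : ℝ) ≤ 2 + Real.log L := by
    have := Nat.ceil_lt_add_one (Real.log_nonneg hL')
    rw [kL]
    push_cast
    linarith
  calc (2 : ℝ) ^ kL L ≤ Real.exp 1 ^ kL L := by gcongr
    _ = Real.exp (kL L) := by rw [← Real.exp_nat_mul, mul_one]
    _ ≤ Real.exp (2 + Real.log L) := Real.exp_le_exp.2 hk
    _ = Real.exp 2 * L := by rw [Real.exp_add, Real.exp_log (by linarith)]

theorem tendsto_sq_mul_exp_neg_sqrt :
    Tendsto (fun L : ℕ => (L : ℝ) * (Real.exp 2 * L * Real.exp (-(Real.sqrt L / 2))))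
      atTop (nhds 0) := by
  have hs : Tendsto (fun L : ℕ => Real.sqrt L / 2) atTop atTop :=
    (Real.tendsto_sqrt_atTop.comp tendsto_natCast_atTop_atTop).atTop_div_const two_pos
  have h := ((Real.tendsto_pow_mul_exp_neg_atTop_nhds_zero 4).comp hs).const_mul (16 * Real.exp 2)
  rw [mul_zero] at h
  refine h.congr fun L => ?_
  have h4 : Real.sqrt L ^ 4 = (L : ℝ) ^ 2 := by
    rw [show 4 = 2 * 2 from rfl, pow_mul, Real.sq_sqrt L.cast_nonneg]
  simp only [Function.comp_apply, div_pow, h4]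
  ring

/-- Let `ξ_L` be the event that in each of `L` independent slots the standard Gaussian
channel vector in `ℝ^L` has at least `k_L = ⌈ln L⌉+1` coordinates with values in
`[−(u_L+δ_L),−u_L] ∪ [u_L,u_L+δ_L]`.  Then `P(ξ_L) → 1` as `L → ∞`. -/
theorem statement15 :
    Tendsto (fun L : ℕ =>
        gaussianSlots L
          {ω : Fin L → Fin L → ℝ | ∀ n : Fin L,
            kL L ≤ (Finset.univ.filter fun i : Fin L =>
              uL L ≤ |ω n i| ∧ |ω n i| ≤ uL L + deltaL L).card})
      atTop (nhds 1) := by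
  classical
  have hlow : Tendsto (fun L : ℕ => ENNReal.ofReal
      (1 - (L : ℝ) * (Real.exp 2 * L * Real.exp (-(Real.sqrt L / 2))))) atTop (nhds 1) := by
    simpa using ENNReal.tendsto_ofReal (tendsto_sq_mul_exp_neg_sqrt.const_sub 1)
  have hprob : ∀ L, IsProbabilityMeasure (gaussianSlots L) := fun L => by
    unfold gaussianSlots; infer_instance
  refine tendsto_of_tendsto_of_tendsto_of_le_of_le' hlow tendsto_const_nhds ?_
    (Eventually.of_forall fun L => prob_le_one)
  filter_upwards [eventually_inv_sqrt_le_gaussianReal, eventually_ge_atTop 1] with L hp hL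
  set S : Set ℝ := {y | uL L ≤ |y| ∧ |y| ≤ uL L + deltaL L} with hSdef
  have hS : MeasurableSet S :=
    (measurableSet_le measurable_const measurable_abs).inter
      (measurableSet_le measurable_abs measurable_const)
  set μ : Measure (Fin L → ℝ) := Measure.pi fun _ => gaussianReal 0 1 with hμ
  set q : ℝ := μ.real {x | (Finset.univ.filter fun i => x i ∈ S).card < kL L} with hq
  have hqle : q ≤ Real.exp 2 * L * Real.exp (-(Real.sqrt L / 2)) := by
    refine (measureReal_pi_card_lt_le _ hS _).trans ?_
    rw [Fintype.card_fin]
    have hsqrt : Real.sqrt L ≤ L * (gaussianReal 0 1).real S := by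
      calc Real.sqrt L = L * (Real.sqrt L)⁻¹ := by
            rw [← div_eq_mul_inv, Real.div_sqrt]
        _ ≤ _ := by gcongr
    gcongr
    exact two_pow_kL_le hL
  have hset : {ω : Fin L → Fin L → ℝ | ∀ n : Fin L,
      kL L ≤ (Finset.univ.filter fun i : Fin L =>
        uL L ≤ |ω n i| ∧ |ω n i| ≤ uL L + deltaL L).card} =
      Set.pi Set.univ fun _ : Fin L =>
        {x : Fin L → ℝ | (Finset.univ.filter fun i => x i ∈ S).card < kL L}ᶜ := by
    ext ω
    simp [hSdef, Set.mem_pi]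
  have hmeas : MeasurableSet
      {x : Fin L → ℝ | (Finset.univ.filter fun i => x i ∈ S).card < kL L} := by
    have : Measurable fun x : Fin L → ℝ => (Finset.univ.filter fun i => x i ∈ S).card := by
      simp only [Finset.card_filter]
      exact Finset.measurable_sum _ fun i _ =>
        Measurable.ite (measurable_pi_apply i hS) measurable_const measurable_const
    exact measurableSet_lt this measurable_const
  have hcompl : μ {x : Fin L → ℝ | (Finset.univ.filter fun i => x i ∈ S).card < kL L}ᶜ =
      ENNReal.ofReal (1 - q) := by
    rw [hq, ← probReal_compl_eq_one_sub hmeas, ofReal_measureReal]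
  have hq1 : q ≤ 1 := measureReal_le_one
  rw [hset, gaussianSlots, Measure.pi_pi, hcompl, Finset.prod_const, Finset.card_univ,
    Fintype.card_fin, ← ENNReal.ofReal_pow (by linarith)]
  refine ENNReal.ofReal_le_ofReal ?_
  calc 1 - (L : ℝ) * (Real.exp 2 * L * Real.exp (-(Real.sqrt L / 2))) ≤ 1 + L * (-q) := by
        rw [mul_neg, ← sub_eq_add_neg]; gcongr
    _ ≤ (1 + -q) ^ L := one_add_mul_le_pow (by linarith) L
    _ = (1 - q) ^ L := by rw [← sub_eq_add_neg]
end
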